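/- arXiv:math/0105016 — 3 statements merged into one kernel-verified Lean document; each statement's English description precedes it below -/
import Mathlib

section
/- There exists a constant b ∈ (1, ∞) with the following property. Let Ω ⊊ ℂ be a nonempty open, connected, simply connected proper subset of ℂ, and let u : Ω → ℝ be a C² function with Δu = e^{2u} on Ω such that u is complete, i.e. for every continuous piecewise-C¹ path γ : [0,1) → Ω that eventually leaves every compact subset of Ω, the length ∫₀¹ e^{u(γ(t))} |γ'(t)| dt is infinite. Then for all p ∈ Ω, (1/2)·dist(p, ∂Ω) ≤ e^{−u(p)} ≤ (b/2)·dist(p, ∂Ω), where dist(p, ∂Ω) = inf{|p − q| : q ∈ ℂ \ Ω}. -/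
/-- The Euclidean Laplacian of `u : ℂ → ℝ` on an (open) set `s`, computed via second
derivatives within `s` in the directions `1` and `I`. -/
noncomputable def laplacianOn (u : ℂ → ℝ) (s : Set ℂ) (z : ℂ) : ℝ :=
  iteratedFDerivWithin ℝ 2 u s z ![1, 1] +
    iteratedFDerivWithin ℝ 2 u s z ![Complex.I, Complex.I]

/-- The conformal metric `e^{2u}|dz|²` on `Ω` is complete: every continuous,
piecewise-C¹ path `γ : [0,1) → Ω` that eventually leaves every compact subset of `Ω`
has infinite length `∫₀¹ e^{u(γ t)} |γ'(t)| dt`. -/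
def ConformallyComplete (u : ℂ → ℝ) (Ω : Set ℂ) : Prop :=
  ∀ γ : ℝ → ℂ,
    ContinuousOn γ (Set.Ico 0 1) →
    (∀ t ∈ Set.Ico (0 : ℝ) 1, γ t ∈ Ω) →
    (∀ s ∈ Set.Ico (0 : ℝ) 1, ∃ n : ℕ, ∃ τ : Fin (n + 1) → ℝ,
      Monotone τ ∧ τ 0 = 0 ∧ τ (Fin.last n) = s ∧
      ∀ i : Fin n, ContDiffOn ℝ 1 γ (Set.Icc (τ i.castSucc) (τ i.succ))) →
    (∀ K : Set ℂ, IsCompact K → K ⊆ Ω →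
      ∃ T, 0 ≤ T ∧ T < 1 ∧ ∀ t, T ≤ t → t < 1 → γ t ∉ K) →
    ∫⁻ t in Set.Ioo (0 : ℝ) 1, ENNReal.ofReal (Real.exp (u (γ t)) * ‖deriv γ t‖) = ⊤

section ODE

open Set Metric Filter Topology
open scoped NNReal

variable {E : Type*} [NormedAddCommGroup E] [NormedSpace ℝ E]

theorem HasDerivWithinAt.Ici_of_Icc {F : Type*} [NormedAddCommGroup F] [NormedSpace ℝ F]
    {f : ℝ → F} {f' : F} {a b t : ℝ}
    (h : HasDerivWithinAt f f' (Icc a b) t) (ht : t ∈ Ico a b) :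
    HasDerivWithinAt f f' (Ici t) t :=
  h.mono_of_mem_nhdsWithin (Icc_mem_nhdsGE_of_mem ht)

/-- Grönwall's inequality for a vector field which is only known to be Lipschitz in a tube around
the approximate solution. -/
theorem dist_le_gronwallBound_of_tube {F : E → E} {K : ℝ≥0} {r ε τ : ℝ} {Y Z Z' : ℝ → E}
    (hF : ∀ t ∈ Icc 0 τ, LipschitzOnWith K F (ball (Z t) r))
    (hZ : ∀ t ∈ Icc 0 τ, HasDerivWithinAt Z (Z' t) (Icc 0 τ) t)
    (hZ' : ∀ t ∈ Icc 0 τ, ‖Z' t - F (Z t)‖ ≤ ε)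
    (hY : ∀ t ∈ Icc 0 τ, HasDerivWithinAt Y (F (Y t)) (Icc 0 τ) t)
    (h0 : Y 0 = Z 0) (hε : 0 ≤ ε) (hr : gronwallBound 0 K ε τ < r) :
    ∀ t ∈ Icc 0 τ, dist (Y t) (Z t) ≤ gronwallBound 0 K ε τ := by
  have hYc : ContinuousOn Y (Icc 0 τ) := fun t ht ↦ (hY t ht).continuousWithinAt
  have hZc : ContinuousOn Z (Icc 0 τ) := fun t ht ↦ (hZ t ht).continuousWithinAt
  have key : ∀ t₁ ∈ Icc 0 τ, (∀ t ∈ Ico 0 t₁, dist (Y t) (Z t) < r) →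
      dist (Y t₁) (Z t₁) ≤ gronwallBound 0 K ε τ := by
    intro t₁ ht₁ h
    have hmem : ∀ t ∈ Ico 0 t₁, t ∈ Icc 0 τ ∧ t ∈ Ico 0 τ := fun t ht ↦
      ⟨⟨ht.1, ht.2.le.trans ht₁.2⟩, ht.1, ht.2.trans_le ht₁.2⟩
    have hsub : Icc 0 t₁ ⊆ Icc 0 τ := Icc_subset_Icc_right ht₁.2
    have := dist_le_of_approx_trajectories_ODE_of_mem (v := fun _ ↦ F) (f := Y) (g := Z)
      (f' := fun t ↦ F (Y t)) (g' := Z') (K := K) (a := 0) (b := t₁) (δ := 0) (εf := 0)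
      (εg := ε) (s := fun t ↦ ball (Z t) r)
      (fun t ht ↦ hF t (hmem t ht).1) (hYc.mono hsub)
      (fun t ht ↦ (hY t (hmem t ht).1).Ici_of_Icc (hmem t ht).2) (fun t _ ↦ by simp)
      (fun t ht ↦ h t ht) (hZc.mono hsub)
      (fun t ht ↦ (hZ t (hmem t ht).1).Ici_of_Icc (hmem t ht).2)
      (fun t ht ↦ by rw [dist_eq_norm]; exact hZ' t (hmem t ht).1)
      (fun t ht ↦ mem_ball_self (dist_nonneg.trans_lt (h t ht))) (by simp [h0]) t₁
      ⟨ht₁.1, le_rfl⟩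
    rw [zero_add, sub_zero] at this
    exact this.trans (gronwallBound_mono le_rfl hε K.2 ht₁.2)
  suffices H : ∀ t ∈ Icc 0 τ, dist (Y t) (Z t) < r from
    fun t ht ↦ key t ht fun s hs ↦ H s ⟨hs.1, hs.2.le.trans ht.2⟩
  by_contra! H
  obtain ⟨t, ht, htr⟩ := H
  have hclosed : IsClosed (Icc 0 τ ∩ (fun t ↦ dist (Y t) (Z t)) ⁻¹' Ici r) :=
    (continuous_dist.comp_continuousOn (hYc.prodMk hZc)).preimage_isClosed_of_isClosed isClosed_Icc isClosed_Ici
  obtain ⟨t₁, ht₁, hmin⟩ := (isCompact_Icc.of_isClosed_subset hclosed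
    inter_subset_left).exists_isLeast ⟨t, ht, htr⟩
  refine absurd (key t₁ ht₁.1 fun s hs ↦ ?_) (not_le.2 (hr.trans_le ht₁.2))
  by_contra! hs'
  exact (hmin ⟨⟨hs.1, hs.2.le.trans ht₁.1.2⟩, hs'⟩).not_gt hs.2

/-- A `C¹` map is uniformly Lipschitz on small balls centred on a compact set. -/
theorem ContDiffOn.exists_lipschitzOnWith_ball {F : E → E} {O C : Set E}
    (hF : ContDiffOn ℝ 1 F O) (hO : IsOpen O) (hC : IsCompact C) (hCO : C ⊆ O) :
    ∃ K : ℝ≥0, ∃ r > 0, ∀ x ∈ C, LipschitzOnWith K F (ball x r) ∧ ball x r ⊆ O := by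
  refine hC.induction_on (p := fun s ↦ ∃ K : ℝ≥0, ∃ r > 0, ∀ x ∈ s,
    LipschitzOnWith K F (ball x r) ∧ ball x r ⊆ O) ⟨0, 1, one_pos, by simp⟩ ?_ ?_ ?_
  · rintro s t hst ⟨K, r, hr, h⟩
    exact ⟨K, r, hr, fun x hx ↦ h x (hst hx)⟩
  · rintro s t ⟨K, r, hr, h⟩ ⟨K', r', hr', h'⟩
    refine ⟨max K K', min r r', lt_min hr hr', ?_⟩
    rintro x (hx | hx)
    · have hb : ball x (min r r') ⊆ ball x r := ball_subset_ball (min_le_left _ _)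
      exact ⟨((h x hx).1.mono hb).weaken (le_max_left _ _), hb.trans (h x hx).2⟩
    · have hb : ball x (min r r') ⊆ ball x r' := ball_subset_ball (min_le_right _ _)
      exact ⟨((h' x hx).1.mono hb).weaken (le_max_right _ _), hb.trans (h' x hx).2⟩
  · intro x hx
    obtain ⟨K, s, hs, hK⟩ :=
      (hF.contDiffAt (hO.mem_nhds (hCO hx))).exists_lipschitzOnWith
    obtain ⟨r, hr, hrs⟩ := Metric.mem_nhds_iff.1 (inter_mem hs (hO.mem_nhds (hCO hx)))
    refine ⟨ball x (r / 2), mem_nhdsWithin_of_mem_nhds (ball_mem_nhds x (half_pos hr)), K, r / 2,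
      half_pos hr, fun y hy ↦ ?_⟩
    have hb : ball y (r / 2) ⊆ ball x r := ball_subset_ball' (by
      have := mem_ball.1 hy; linarith)
    exact ⟨hK.mono (hb.trans (hrs.trans inter_subset_left)),
      hb.trans (hrs.trans inter_subset_right)⟩

/-- `X` solves the autonomous equation `X' = F X` in `O` on `[0, τ]` with initial value `x`. -/
structure IsSolutionOn (F : E → E) (O : Set E) (x : E) (τ : ℝ) (X : ℝ → E) : Prop where
  init : X 0 = x
  mem : ∀ t ∈ Icc 0 τ, X t ∈ O
  deriv : ∀ t ∈ Icc 0 τ, HasDerivWithinAt X (F (X t)) (Icc 0 τ) t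

namespace IsSolutionOn

variable {F : E → E} {O : Set E} {x : E} {τ τ' : ℝ} {X Y : ℝ → E}

theorem continuousOn (h : IsSolutionOn F O x τ X) : ContinuousOn X (Icc 0 τ) :=
  fun t ht ↦ (h.deriv t ht).continuousWithinAt

theorem mono (h : IsSolutionOn F O x τ X) (hτ : τ' ≤ τ) : IsSolutionOn F O x τ' X where
  init := h.init
  mem t ht := h.mem t ⟨ht.1, ht.2.trans hτ⟩
  deriv t ht := (h.deriv t ⟨ht.1, ht.2.trans hτ⟩).mono (Icc_subset_Icc_right hτ)

theorem eqOn (hF : ContDiffOn ℝ 1 F O) (hO : IsOpen O) (hX : IsSolutionOn F O x τ X)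
    (hY : IsSolutionOn F O x τ Y) : EqOn X Y (Icc 0 τ) := by
  obtain ⟨K, r, hr, h⟩ := hF.exists_lipschitzOnWith_ball hO
    (isCompact_Icc.image_of_continuousOn hY.continuousOn) (image_subset_iff.2 hY.mem)
  intro t ht
  have := dist_le_gronwallBound_of_tube (Z' := fun t ↦ F (Y t)) (ε := 0)
    (fun s hs ↦ (h _ (mem_image_of_mem Y hs)).1) hY.deriv (fun s _ ↦ by simp) hX.deriv
    (hX.init.trans hY.init.symm) le_rfl (by simpa [gronwallBound_ε0_δ0] using hr) t ht
  rw [gronwallBound_ε0_δ0] at this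
  exact dist_le_zero.1 this

/-- Continuing a solution by a solution started at its endpoint. -/
theorem exists_append (hτ : 0 ≤ τ) (hτ' : 0 ≤ τ') (hX : IsSolutionOn F O x τ X)
    (hY : IsSolutionOn F O (X τ) τ' Y) :
    ∃ Z, IsSolutionOn F O x (τ + τ') Z := by
  classical
  have hY0 := hY.init
  set Z : ℝ → E := fun t ↦ if t ≤ τ then X t else Y (t - τ) with hZ
  have hZX : ∀ t ≤ τ, Z t = X t := fun t ht ↦ by simp [hZ, ht]
  have hZY : ∀ t, τ ≤ t → Z t = Y (t - τ) := by
    intro t ht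
    rcases ht.eq_or_lt with rfl | ht
    · simp [hZ, hY0]
    · simp [hZ, not_le.2 ht]
  have hun : Icc 0 (τ + τ') = Icc 0 τ ∪ Icc τ (τ + τ') :=
    (Icc_union_Icc_eq_Icc hτ (by linarith)).symm
  have h1 : ∀ t ∈ Icc 0 τ, HasDerivWithinAt Z (F (Z t)) (Icc 0 τ) t := fun t ht ↦ by
    rw [hZX t ht.2]
    exact (hX.deriv t ht).congr (fun s hs ↦ hZX s hs.2) (hZX t ht.2)
  have h2 : ∀ t ∈ Icc τ (τ + τ'), HasDerivWithinAt Z (F (Z t)) (Icc τ (τ + τ')) t := fun t ht ↦ by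
    rw [hZY t ht.1]
    have hm : MapsTo (fun s ↦ s - τ) (Icc τ (τ + τ')) (Icc 0 τ') := fun s hs ↦
      ⟨by linarith [hs.1], by linarith [hs.2]⟩
    have := (hY.deriv (t - τ) (hm ht)).scomp t ((hasDerivWithinAt_id t _).sub_const τ) hm
    rw [one_smul] at this
    exact this.congr (fun s hs ↦ hZY s hs.1) (hZY t ht.1)
  refine ⟨Z, by rw [hZX 0 hτ, hX.init], fun t ht ↦ ?_, fun t ht ↦ ?_⟩
  · rcases le_total t τ with h | h
    · rw [hZX t h]
      exact hX.mem t ⟨ht.1, h⟩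
    · rw [hZY t h]
      exact hY.mem _ ⟨by linarith, by linarith [ht.2]⟩
  · rw [hun]
    refine HasDerivWithinAt.union ?_ ?_
    · rcases le_or_gt t τ with h | h
      · exact h1 t ⟨ht.1, h⟩
      · exact HasFDerivWithinAt.of_notMem_closure (by
          rw [isClosed_Icc.closure_eq]; exact fun h' ↦ not_le.2 h h'.2)
    · rcases le_or_gt τ t with h | h
      · exact h2 t ⟨h, ht.2⟩
      · exact HasFDerivWithinAt.of_notMem_closure (by
          rw [isClosed_Icc.closure_eq]; exact fun h' ↦ not_le.2 h h'.1)

end IsSolutionOn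

variable [CompleteSpace E]

/-- Solutions started in a compact set exist for a uniform time. -/
theorem exists_uniform_isSolutionOn {F : E → E} {O C : Set E}
    (hF : ContDiffOn ℝ 1 F O) (hO : IsOpen O) (hC : IsCompact C) (hCO : C ⊆ O) :
    ∃ ε > 0, ∀ x ∈ C, ∃ X, IsSolutionOn F O x ε X := by
  refine hC.induction_on (p := fun s ↦ ∃ ε > 0, ∀ x ∈ s, ∃ X, IsSolutionOn F O x ε X)
    ⟨1, one_pos, by simp⟩ ?_ ?_ ?_
  · rintro s t hst ⟨ε, hε, h⟩
    exact ⟨ε, hε, fun x hx ↦ h x (hst hx)⟩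
  · rintro s t ⟨ε, hε, h⟩ ⟨ε', hε', h'⟩
    refine ⟨min ε ε', lt_min hε hε', ?_⟩
    rintro x (hx | hx)
    · exact (h x hx).imp fun X hX ↦ hX.mono (min_le_left _ _)
    · exact (h' x hx).imp fun X hX ↦ hX.mono (min_le_right _ _)
  · intro x hx
    obtain ⟨ε, hε, a, r, L, K, hr, hpl⟩ :=
      IsPicardLindelof.of_contDiffAt_one (hF.contDiffAt (hO.mem_nhds (hCO hx)))
    obtain ⟨α, hα, hαc⟩ :=
      (hpl 0).exists_forall_mem_closedBall_eq_hasDerivWithinAt_continuousOn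
    have hmem : closedBall x (r : ℝ) ×ˢ Icc (0 - ε) (0 + ε) ∈ 𝓝 (x, (0 : ℝ)) :=
      prod_mem_nhds (closedBall_mem_nhds x hr) (Icc_mem_nhds (by linarith) (by linarith))
    have hO' : α ⁻¹' O ∈ 𝓝 (x, (0 : ℝ)) := (hαc.continuousAt hmem).preimage_mem_nhds
      (hO.mem_nhds (by
        have := (hα x (mem_closedBall_self r.2)).1
        simp only at this
        rw [this]; exact hCO hx))
    obtain ⟨δ, hδ, hsub⟩ := Metric.mem_nhds_iff.1 (inter_mem hmem hO')
    refine ⟨ball x δ, mem_nhdsWithin_of_mem_nhds (ball_mem_nhds x hδ), δ / 2, half_pos hδ,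
      fun y hy ↦ ⟨fun t ↦ α (y, t), ?_⟩⟩
    have hin : ∀ t ∈ Icc 0 (δ / 2), (y, t) ∈ ball (x, (0 : ℝ)) δ := fun t ht ↦ by
      rw [← ball_prod_same]
      refine ⟨hy, ?_⟩
      rw [mem_ball, Real.dist_0_eq_abs, abs_of_nonneg ht.1]
      linarith [ht.2]
    have hy' := (hsub (hin 0 ⟨le_rfl, (half_pos hδ).le⟩)).1.1
    refine ⟨(hα y hy').1, fun t ht ↦ (hsub (hin t ht)).2, fun t ht ↦ ?_⟩
    exact ((hα y hy').2 t (hsub (hin t ht)).1.2).mono fun s hs ↦ (hsub (hin s hs)).1.2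

/-- A solution of an autonomous equation either exists on `[0, 1]`, or it leaves every compact set
at some time `T ≤ 1`. -/
theorem exists_isSolutionOn_or_escape {F : E → E} {O : Set E} {x : E}
    (hF : ContDiffOn ℝ 1 F O) (hO : IsOpen O) (hx : x ∈ O) :
    (∃ X, IsSolutionOn F O x 1 X) ∨
    ∃ T > 0, T ≤ 1 ∧ ∃ X, (∀ τ < T, IsSolutionOn F O x τ X) ∧
      ∀ C, IsCompact C → C ⊆ O → ∃ T₀ < T, ∀ t, T₀ < t → t < T → X t ∉ C := by
  by_cases h1 : ∃ X, IsSolutionOn F O x 1 X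
  · exact Or.inl h1
  right
  set S : Set ℝ := {τ | ∃ X, IsSolutionOn F O x τ X} with hS
  have hdown : ∀ τ ∈ S, ∀ τ' ≤ τ, τ' ∈ S := fun τ ⟨X, hX⟩ τ' h ↦ ⟨X, hX.mono h⟩
  have hlt : ∀ τ ∈ S, τ < 1 := fun τ hτ ↦ by
    by_contra! h
    exact h1 (hdown τ hτ 1 h)
  have hbdd : BddAbove S := ⟨1, fun τ hτ ↦ (hlt τ hτ).le⟩
  obtain ⟨ε, hε, hloc⟩ := exists_uniform_isSolutionOn hF hO isCompact_singleton
    (singleton_subset_iff.2 hx)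
  have hεS : ε ∈ S := hloc x rfl
  have hT : ∀ τ < sSup S, τ ∈ S := fun τ hτ ↦ by
    obtain ⟨τ', h', hlt'⟩ := exists_lt_of_lt_csSup ⟨ε, hεS⟩ hτ
    exact hdown τ' h' τ hlt'.le
  have hT' : ∀ t, ∃ Y : ℝ → E, t < sSup S → IsSolutionOn F O x ((t + sSup S) / 2) Y := fun t ↦ by
    by_cases ht : t < sSup S
    · exact (hT ((t + sSup S) / 2) (by linarith)).imp fun Y hY _ ↦ hY
    · exact ⟨0, fun h ↦ absurd h ht⟩
  choose Y hY using hT'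
  have hsol : ∀ τ < sSup S, IsSolutionOn F O x τ (fun t ↦ Y t t) := by
    intro τ hτ
    have heq : ∀ t ∈ Icc 0 τ, Y t t = Y τ t := fun t ht ↦
      IsSolutionOn.eqOn hF hO ((hY t (ht.2.trans_lt hτ)).mono (by linarith [ht.2.trans_lt hτ]))
        ((hY τ hτ).mono (by linarith [ht.2])) ⟨ht.1, le_rfl⟩
    have hYτ := (hY τ hτ).mono (show τ ≤ (τ + sSup S) / 2 by linarith)
    refine ⟨(hY 0 ((hε.trans_le (le_csSup hbdd hεS)))).init, fun t ht ↦ ?_, fun t ht ↦ ?_⟩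
    · simp only [heq t ht]
      exact hYτ.mem t ht
    · simp only [heq t ht]
      exact (hYτ.deriv t ht).congr heq (heq t ht)
  refine ⟨sSup S, hε.trans_le (le_csSup hbdd hεS), csSup_le ⟨ε, hεS⟩ fun τ hτ ↦ (hlt τ hτ).le,
    fun t ↦ Y t t, hsol, fun C hC hCO ↦ ?_⟩
  obtain ⟨δ, hδ, hunif⟩ := exists_uniform_isSolutionOn hF hO hC hCO
  refine ⟨max 0 (sSup S - δ), max_lt (hε.trans_le (le_csSup hbdd hεS)) (by linarith),
    fun t ht htT htC ↦ ?_⟩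
  obtain ⟨Z, hZ⟩ := hunif _ htC
  have hmem : t + δ ∈ S := (hsol t htT).exists_append (max_lt_iff.1 ht).1.le hδ.le hZ
  linarith [le_csSup hbdd hmem, (max_lt_iff.1 ht).2]

end ODE

section Parameter

open Set Metric Filter Topology
open scoped NNReal

variable {E : Type*} [NormedAddCommGroup E] [NormedSpace ℝ E]

/-- A `C¹` map is differentiable uniformly along a compact set. -/
theorem ContDiffOn.exists_uniform_linearization {W : E → E} {O C : Set E}
    (hW : ContDiffOn ℝ 1 W O) (hO : IsOpen O) (hC : IsCompact C) (hCO : C ⊆ O) {η : ℝ}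
    (hη : 0 < η) :
    ∃ ρ > 0, ∀ x ∈ C, ∀ w, ‖w‖ < ρ → ‖W (x + w) - W x - fderiv ℝ W x w‖ ≤ η * ‖w‖ := by
  refine hC.induction_on (p := fun s ↦ ∃ ρ > 0, ∀ x ∈ s, ∀ w, ‖w‖ < ρ →
    ‖W (x + w) - W x - fderiv ℝ W x w‖ ≤ η * ‖w‖) ⟨1, one_pos, by simp⟩ ?_ ?_ ?_
  · rintro s t hst ⟨ρ, hρ, h⟩
    exact ⟨ρ, hρ, fun x hx ↦ h x (hst hx)⟩
  · rintro s t ⟨ρ, hρ, h⟩ ⟨ρ', hρ', h'⟩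
    refine ⟨min ρ ρ', lt_min hρ hρ', ?_⟩
    rintro x (hx | hx) w hw
    · exact h x hx w (hw.trans_le (min_le_left _ _))
    · exact h' x hx w (hw.trans_le (min_le_right _ _))
  · intro x hx
    have hxO := hO.mem_nhds (hCO hx)
    have hstrict := (hW.contDiffAt hxO).hasStrictFDerivAt one_ne_zero
    have hcont : ContinuousAt (fderiv ℝ W) x :=
      (hW.continuousOn_fderiv_of_isOpen hO le_rfl).continuousAt hxO
    have h1 := hstrict.isLittleO.def (half_pos hη)
    have h2 : ∀ᶠ y in 𝓝 x, ‖fderiv ℝ W y - fderiv ℝ W x‖ < η / 2 := by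
      have := Metric.tendsto_nhds.1 hcont (η / 2) (half_pos hη)
      simpa [dist_eq_norm] using this
    rw [Metric.eventually_nhds_iff_ball] at h1 h2
    obtain ⟨δ₁, hδ₁, h1⟩ := h1
    obtain ⟨δ₂, hδ₂, h2⟩ := h2
    set δ := min δ₁ δ₂ / 2 with hδ
    have hδ0 : 0 < δ := half_pos (lt_min hδ₁ hδ₂)
    refine ⟨ball x δ, mem_nhdsWithin_of_mem_nhds (ball_mem_nhds x hδ0), δ, hδ0,
      fun y hy w hw ↦ ?_⟩
    have hy' := mem_ball.1 hy
    have hy₂ : ‖fderiv ℝ W y - fderiv ℝ W x‖ < η / 2 :=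
      h2 y (mem_ball.2 (by linarith [min_le_right δ₁ δ₂]))
    have hyw : ‖W (y + w) - W y - fderiv ℝ W x (y + w - y)‖ ≤ η / 2 * ‖y + w - y‖ := by
      refine h1 (y + w, y) ?_
      rw [← ball_prod_same]
      constructor
      · rw [mem_ball]
        have := dist_triangle (y + w) y x
        rw [dist_self_add_left] at this
        linarith [min_le_left δ₁ δ₂]
      · rw [mem_ball]
        linarith [min_le_left δ₁ δ₂]
    rw [add_sub_cancel_left] at hyw
    have hlin : ‖(fderiv ℝ W y - fderiv ℝ W x) w‖ ≤ η / 2 * ‖w‖ :=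
      (ContinuousLinearMap.le_opNorm _ _).trans (by gcongr)
    calc ‖W (y + w) - W y - fderiv ℝ W y w‖
        = ‖(W (y + w) - W y - fderiv ℝ W x w) - (fderiv ℝ W y - fderiv ℝ W x) w‖ := by
          congr 1
          simp only [sub_apply]
          abel
      _ ≤ η / 2 * ‖w‖ + η / 2 * ‖w‖ := (norm_sub_le _ _).trans (add_le_add hyw hlin)
      _ = η * ‖w‖ := by ring

theorem gronwallBound_zero_eq_mul (K ε x : ℝ) :
    gronwallBound 0 K ε x = ε * gronwallBound 0 K 1 x := by
  by_cases hK : K = 0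
  · simp [hK, gronwallBound_K0]
  · rw [gronwallBound_of_K_ne_0 hK, gronwallBound_of_K_ne_0 hK]
    ring

variable [NormedSpace ℂ E] [IsScalarTower ℝ ℂ E]

/-- If the derivative of `W` acts complex linearly on the line spanned by `W` along the solution of
`X' = ζ • W X`, then the time-one map of this equation is complex differentiable in `ζ`. -/
theorem hasDerivAt_of_isSolutionOn_smul {W : E → E} {O : Set E} (hW : ContDiffOn ℝ 1 W O)
    (hO : IsOpen O) {x₀ : E} {X : ℂ → ℝ → E} {ζ : ℂ} (hζ : ζ ∈ ball 0 1)
    (hX : ∀ ζ ∈ ball 0 1, IsSolutionOn (fun x ↦ ζ • W x) O x₀ 1 (X ζ))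
    (hcomm : ∀ t ∈ Icc (0 : ℝ) 1, ∀ c : ℂ,
      fderiv ℝ W (X ζ t) (c • W (X ζ t)) = c • fderiv ℝ W (X ζ t) (W (X ζ t))) :
    HasDerivAt (fun ζ ↦ X ζ 1) (W (X ζ 1)) ζ := by
  have hXζ := hX ζ hζ
  set C := X ζ '' Icc 0 1 with hCdef
  have hC : IsCompact C := isCompact_Icc.image_of_continuousOn hXζ.continuousOn
  have hCO : C ⊆ O := image_subset_iff.2 hXζ.mem
  have hXC : ∀ t ∈ Icc (0 : ℝ) 1, X ζ t ∈ C := fun t ht ↦ mem_image_of_mem _ ht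
  obtain ⟨K, r, hr, hK⟩ := hW.exists_lipschitzOnWith_ball hO hC hCO
  obtain ⟨M, hM⟩ := hC.exists_bound_of_continuousOn (hW.continuousOn.mono hCO)
  have hM0 : 0 ≤ M := (norm_nonneg _).trans (hM _ (hXC 0 ⟨le_rfl, zero_le_one⟩))
  set B := gronwallBound 0 K 1 1 with hB
  have hB0 : 0 ≤ B := by
    have := gronwallBound_mono le_rfl zero_le_one K.2 (zero_le_one (α := ℝ)) (δ := 0)
    rwa [gronwallBound_x0] at this
  rw [hasDerivAt_iff_isLittleO_nhds_zero, Asymptotics.isLittleO_iff]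
  intro η hη
  set η' := η / (2 * M * B + 1) with hη'
  have hη'0 : 0 < η' := by positivity
  have hη'η : 2 * η' * M * B ≤ η := by
    rw [hη', ← sub_nonneg]
    have : η - 2 * (η / (2 * M * B + 1)) * M * B = η / (2 * M * B + 1) := by
      field_simp; ring
    rw [this]; positivity
  obtain ⟨ρ, hρ, hlin⟩ := hW.exists_uniform_linearization hO hC hCO hη'0
  have e1 : ∀ᶠ h : ℂ in 𝓝 0, ζ + h ∈ ball (0 : ℂ) 1 := by
    have : Tendsto (fun h : ℂ ↦ ζ + h) (𝓝 0) (𝓝 ζ) := by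
      simpa using (continuous_const_add ζ).tendsto 0
    exact this (isOpen_ball.mem_nhds hζ)
  have small : ∀ (a b : ℝ), 0 < b → ∀ᶠ h : ℂ in 𝓝 0, ‖h‖ * a < b := fun a b hb ↦ by
    have : Tendsto (fun h : ℂ ↦ ‖h‖ * a) (𝓝 0) (𝓝 0) := by
      have := (continuous_norm.mul continuous_const).tendsto (X := ℂ) (f := fun h ↦ ‖h‖ * a) 0
      simpa using this
    exact this.eventually_lt_const hb
  filter_upwards [e1, small M ρ hρ, small M (r / 2) (half_pos hr), small K η' hη'0,
    small η (r / 2) (half_pos hr)] with h hh hhρ hhr hhK hhη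
  have hw : ∀ t ∈ Icc (0 : ℝ) 1, ‖((t : ℂ) * h) • W (X ζ t)‖ ≤ ‖h‖ * M := fun t ht ↦ by
    rw [norm_smul, norm_mul, Complex.norm_real, Real.norm_of_nonneg ht.1]
    calc t * ‖h‖ * ‖W (X ζ t)‖ ≤ 1 * ‖h‖ * M := by
          gcongr
          · exact ht.2
          · exact hM _ (hXC t ht)
      _ = ‖h‖ * M := by ring
  have hdiff : ∀ t ∈ Icc (0 : ℝ) 1, DifferentiableAt ℝ W (X ζ t) := fun t ht ↦
    (hW.contDiffAt (hO.mem_nhds (hXζ.mem t ht))).differentiableAt one_ne_zero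
  have main := dist_le_gronwallBound_of_tube (F := fun x ↦ (ζ + h) • W x) (K := K) (r := r / 2)
    (ε := 2 * η' * M * ‖h‖) (τ := 1) (Y := X (ζ + h))
    (Z := fun t ↦ X ζ t + ((t : ℂ) * h) • W (X ζ t))
    (Z' := fun t ↦ ζ • W (X ζ t) + (((t : ℂ) * h) • fderiv ℝ W (X ζ t) (ζ • W (X ζ t))
      + h • W (X ζ t))) ?_ ?_ ?_ ((hX _ hh).deriv) ?_ (by positivity) ?_ 1 ⟨zero_le_one, le_rfl⟩
  · rw [gronwallBound_zero_eq_mul, dist_eq_norm] at main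
    calc ‖X (ζ + h) 1 - X ζ 1 - h • W (X ζ 1)‖
        = ‖X (ζ + h) 1 - (X ζ 1 + (((1 : ℝ) : ℂ) * h) • W (X ζ 1))‖ := by
          rw [Complex.ofReal_one, one_mul, sub_sub]
      _ ≤ 2 * η' * M * ‖h‖ * B := main
      _ = 2 * η' * M * B * ‖h‖ := by ring
      _ ≤ η * ‖h‖ := by gcongr
  · intro t ht
    have hb : ball (X ζ t + ((t : ℂ) * h) • W (X ζ t)) (r / 2) ⊆ ball (X ζ t) r :=
      ball_subset_ball' (by
        rw [dist_self_add_left]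
        linarith [hw t ht])
    refine LipschitzOnWith.of_dist_le_mul fun x hx y hy ↦ ?_
    rw [dist_eq_norm, ← smul_sub, norm_smul, ← dist_eq_norm]
    have hL := ((hK _ (hXC t ht)).1.mono hb).dist_le_mul x hx y hy
    have h1 : ‖ζ + h‖ ≤ 1 := (mem_ball_zero_iff.1 hh).le
    calc ‖ζ + h‖ * dist (W x) (W y) ≤ 1 * dist (W x) (W y) := by gcongr
      _ ≤ K * dist x y := by rwa [one_mul]
  · intro t ht
    have hd := hXζ.deriv t ht
    have hWd := (hdiff t ht).hasFDerivAt.comp_hasDerivWithinAt t hd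
    have hc : HasDerivWithinAt (fun s : ℝ ↦ (s : ℂ) * h) h (Icc 0 1) t := by
      have := ((Complex.ofRealCLM.hasDerivAt (x := t)).mul_const h).hasDerivWithinAt (s := Icc 0 1)
      simpa using this
    exact hd.add (hc.smul hWd)
  · intro t ht
    have hl := hlin _ (hXC t ht) (((t : ℂ) * h) • W (X ζ t)) ((hw t ht).trans_lt hhρ)
    have hLip := (hK _ (hXC t ht)).1.dist_le_mul (X ζ t + ((t : ℂ) * h) • W (X ζ t))
      (mem_ball.2 (by rw [dist_self_add_left]; linarith [hw t ht])) (X ζ t) (mem_ball_self hr)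
    rw [dist_self_add_left, dist_eq_norm] at hLip
    have hcζ := hcomm t ht ζ
    have hct := hcomm t ht ((t : ℂ) * h)
    set w := ((t : ℂ) * h) • W (X ζ t) with hwdef
    have hwt := hw t ht
    rw [← hwdef] at hwt
    have hsplit : ζ • W (X ζ t) + (((t : ℂ) * h) • fderiv ℝ W (X ζ t) (ζ • W (X ζ t))
        + h • W (X ζ t)) - (ζ + h) • W (X ζ t + w)
        = -(ζ • (W (X ζ t + w) - W (X ζ t) - fderiv ℝ W (X ζ t) w)
          + h • (W (X ζ t + w) - W (X ζ t))) := by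
      rw [hcζ, hct]
      module
    rw [hsplit, norm_neg]
    have hζ1 : ‖ζ‖ ≤ 1 := (mem_ball_zero_iff.1 hζ).le
    calc _ ≤ ‖ζ‖ * ‖W (X ζ t + w) - W (X ζ t) - fderiv ℝ W (X ζ t) w‖
          + ‖h‖ * ‖W (X ζ t + w) - W (X ζ t)‖ := by
          refine (norm_add_le _ _).trans ?_
          rw [norm_smul, norm_smul]
      _ ≤ 1 * (η' * (‖h‖ * M)) + ‖h‖ * (K * (‖h‖ * M)) := by
          gcongr
          · exact hl.trans (by gcongr)
          · exact hLip.trans (by gcongr)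
      _ = η' * M * ‖h‖ + (‖h‖ * K) * M * ‖h‖ := by ring
      _ ≤ η' * M * ‖h‖ + η' * M * ‖h‖ := by gcongr
      _ = 2 * η' * M * ‖h‖ := by ring
  · simp only [Complex.ofReal_zero, zero_mul, zero_smul, add_zero]
    rw [(hX _ hh).init, hXζ.init]
  · rw [gronwallBound_zero_eq_mul]
    calc 2 * η' * M * ‖h‖ * B = 2 * η' * M * B * ‖h‖ := by ring
      _ ≤ η * ‖h‖ := by gcongr
      _ < r / 2 := by linarith

end Parameter

section Field

open Set Metric Filter Topology ComplexConjugate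

variable {u : ℂ → ℝ} {Ω : Set ℂ}

/-- The Wirtinger derivative `∂u/∂z` of a real function. -/
noncomputable def wirtinger (u : ℂ → ℝ) (z : ℂ) : ℂ :=
  ((fderiv ℝ u z 1 : ℝ) - Complex.I * (fderiv ℝ u z Complex.I : ℝ)) / 2

theorem fderiv_apply_eq_two_re_wirtinger (u : ℂ → ℝ) (z w : ℂ) :
    fderiv ℝ u z w = 2 * (wirtinger u z * w).re := by
  have hw : w = w.re • (1 : ℂ) + w.im • Complex.I := by
    simp [Complex.re_add_im]
  conv_lhs => rw [hw]
  simp only [map_add, map_smul, smul_eq_mul, wirtinger]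
  simp
  ring

theorem laplacianOn_eq (hΩ : IsOpen Ω) {z : ℂ} (hz : z ∈ Ω) :
    laplacianOn u Ω z = fderiv ℝ (fderiv ℝ u) z 1 1
      + fderiv ℝ (fderiv ℝ u) z Complex.I Complex.I := by
  simp only [laplacianOn, iteratedFDerivWithin_of_isOpen 2 hΩ hz, iteratedFDeriv_two_apply]
  simp

theorem contDiffOn_fderiv (hΩ : IsOpen Ω) (hu : ContDiffOn ℝ 2 u Ω) :
    ContDiffOn ℝ 1 (fderiv ℝ u) Ω :=
  hu.fderiv_of_isOpen hΩ (by norm_num)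

theorem contDiffOn_wirtinger (hΩ : IsOpen Ω) (hu : ContDiffOn ℝ 2 u Ω) :
    ContDiffOn ℝ 1 (wirtinger u) Ω := by
  have h := contDiffOn_fderiv hΩ hu
  have h' : ∀ v : ℂ, ContDiffOn ℝ 1 (fun z ↦ ((fderiv ℝ u z v : ℝ) : ℂ)) Ω := fun v ↦
    Complex.ofRealCLM.contDiff.comp_contDiffOn (h.clm_apply contDiffOn_const)
  exact ((h' 1).sub (contDiffOn_const.mul (h' Complex.I))).div_const 2

theorem hasFDerivAt_wirtinger (hΩ : IsOpen Ω) (hu : ContDiffOn ℝ 2 u Ω) {z : ℂ} (hz : z ∈ Ω) :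
    ∃ α : ℂ, HasFDerivAt (wirtinger u) (α • (ContinuousLinearMap.id ℝ ℂ)
      + ((laplacianOn u Ω z / 4 : ℝ) : ℂ) • (Complex.conjCLE : ℂ →L[ℝ] ℂ)) z := by
  have hd : HasFDerivAt (fderiv ℝ u) (fderiv ℝ (fderiv ℝ u) z) z :=
    (((contDiffOn_fderiv hΩ hu).contDiffAt (hΩ.mem_nhds hz)).differentiableAt
      one_ne_zero).hasFDerivAt
  have hsymm : fderiv ℝ (fderiv ℝ u) z 1 Complex.I = fderiv ℝ (fderiv ℝ u) z Complex.I 1 :=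
    ((hu.contDiffAt (hΩ.mem_nhds hz)).isSymmSndFDerivAt (by simp)) 1 Complex.I
  have h' : ∀ v : ℂ, HasFDerivAt (fun z ↦ ((fderiv ℝ u z v : ℝ) : ℂ)) _ z := fun v ↦
    Complex.ofRealCLM.hasFDerivAt.comp z (hd.clm_apply (hasFDerivAt_const v z))
  have h1 := ((h' 1).sub ((h' Complex.I).const_mul Complex.I)).mul_const (2⁻¹ : ℂ)
  set D := fderiv ℝ (fderiv ℝ u) z with hD
  refine ⟨((D 1 1 - D Complex.I Complex.I : ℝ) - 2 * Complex.I * (D 1 Complex.I : ℝ)) / 4, ?_⟩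
  refine (h1.congr_fderiv ?_).congr_of_eventuallyEq
    (Eventually.of_forall fun y ↦ by simp [wirtinger, div_eq_mul_inv])
  rw [laplacianOn_eq hΩ hz]
  ext w
  have hw : w = w.re • (1 : ℂ) + w.im • Complex.I := by
    simp [Complex.re_add_im]
  have e1 : D w 1 = w.re * D 1 1 + w.im * D 1 Complex.I := by
    conv_lhs => rw [hw, map_add, map_smul, map_smul]
    simp only [add_apply, smul_apply, smul_eq_mul, hsymm]
  have e2 : D w Complex.I = w.re * D 1 Complex.I + w.im * D Complex.I Complex.I := by
    conv_lhs => rw [hw, map_add, map_smul, map_smul]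
    simp only [add_apply, smul_apply, smul_eq_mul]
  apply Complex.ext
  · simp [e1, e2]
    ring
  · simp [e1, e2]
    ring

/-- The coefficient `2 conj s / (1 - |s|²)`, twice the Wirtinger derivative of the logarithm of
the conformal factor of the hyperbolic metric of the unit disc. -/
noncomputable def discCoeff (s : ℂ) : ℂ := 2 * conj s * (1 - s * conj s)⁻¹

theorem one_sub_mul_conj (s : ℂ) : 1 - s * conj s = ((1 - ‖s‖ ^ 2 : ℝ) : ℂ) := by
  rw [Complex.mul_conj, Complex.normSq_eq_norm_sq]
  push_cast
  rfl

theorem one_sub_mul_conj_ne_zero {s : ℂ} (hs : ‖s‖ < 1) : 1 - s * conj s ≠ 0 := by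
  rw [one_sub_mul_conj]
  have : ‖s‖ ^ 2 < 1 := by nlinarith [norm_nonneg s]
  exact_mod_cast (sub_pos.2 this).ne'

theorem hasFDerivAt_discCoeff {s : ℂ} (hs : ‖s‖ < 1) :
    ∃ α : ℂ, HasFDerivAt discCoeff (α • (ContinuousLinearMap.id ℝ ℂ)
      + (2 * (1 - s * conj s)⁻¹ ^ 2) • (Complex.conjCLE : ℂ →L[ℝ] ℂ)) s := by
  have h0 := one_sub_mul_conj_ne_zero hs
  have hc : HasFDerivAt (fun s : ℂ ↦ conj s) (Complex.conjCLE : ℂ →L[ℝ] ℂ) s :=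
    Complex.conjCLE.hasFDerivAt
  have h1 := ((hasFDerivAt_id (𝕜 := ℝ) s).mul hc).const_sub 1
  have h2 := (hc.const_mul 2).mul ((hasFDerivAt_inv' (𝕜 := ℝ) h0).comp s h1)
  refine ⟨2 * conj s ^ 2 * (1 - s * conj s)⁻¹ ^ 2, h2.congr_fderiv ?_⟩
  ext w
  simp
  field_simp
  ring

theorem contDiffOn_discCoeff : ContDiffOn ℝ 1 discCoeff (ball 0 1) := by
  have hc : ContDiffOn ℝ 1 (fun s : ℂ ↦ conj s) (ball 0 1) := Complex.conjCLE.contDiff.contDiffOn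
  exact (contDiffOn_const.mul hc).mul ((contDiffOn_const.sub (contDiffOn_id.mul hc)).inv
    fun s hs ↦ one_sub_mul_conj_ne_zero (mem_ball_zero_iff.1 hs))

/-- The vector field whose solutions are the radial restrictions `(s, f s, f' s)` of the local
isometries `f` from the hyperbolic disc to `e^{2u}|dz|²`. -/
noncomputable def isometryField (u : ℂ → ℝ) (x : ℂ × ℂ × ℂ) : ℂ × ℂ × ℂ :=
  (1, x.2.2, x.2.2 * (discCoeff x.1 - 2 * wirtinger u x.2.1 * x.2.2))

theorem contDiffOn_isometryField (hΩ : IsOpen Ω) (hu : ContDiffOn ℝ 2 u Ω) :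
    ContDiffOn ℝ 1 (isometryField u) (ball 0 1 ×ˢ Ω ×ˢ univ) := by
  have h1 : ContDiffOn ℝ 1 (fun x : ℂ × ℂ × ℂ ↦ discCoeff x.1) (ball 0 1 ×ˢ Ω ×ˢ univ) :=
    contDiffOn_discCoeff.comp contDiff_fst.contDiffOn fun x hx ↦ hx.1
  have h2 : ContDiffOn ℝ 1 (fun x : ℂ × ℂ × ℂ ↦ wirtinger u x.2.1) (ball 0 1 ×ˢ Ω ×ˢ univ) :=
    (contDiffOn_wirtinger hΩ hu).comp (contDiff_fst.comp contDiff_snd).contDiffOn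
      fun x hx ↦ hx.2.1
  have h3 : ContDiffOn ℝ 1 (fun x : ℂ × ℂ × ℂ ↦ x.2.2) (ball 0 1 ×ˢ Ω ×ˢ univ) :=
    (contDiff_snd.comp contDiff_snd).contDiffOn
  exact contDiffOn_const.prodMk (h3.prodMk (h3.mul (h1.sub ((contDiffOn_const.mul h2).mul h3))))

theorem fderiv_isometryField_smul (hΩ : IsOpen Ω) (hu : ContDiffOn ℝ 2 u Ω) {x : ℂ × ℂ × ℂ}
    (hs : ‖x.1‖ < 1) (hx : x.2.1 ∈ Ω)
    (hlap : laplacianOn u Ω x.2.1 = Real.exp (2 * u x.2.1))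
    (hN : ‖x.2.2‖ ^ 2 * Real.exp (2 * u x.2.1) * (1 - ‖x.1‖ ^ 2) ^ 2 = 4) (c : ℂ) :
    fderiv ℝ (isometryField u) x (c • isometryField u x)
      = c • fderiv ℝ (isometryField u) x (isometryField u x) := by
  obtain ⟨α, hα⟩ := hasFDerivAt_discCoeff hs
  obtain ⟨β, hβ⟩ := hasFDerivAt_wirtinger hΩ hu hx
  have hv : HasFDerivAt (fun x : ℂ × ℂ × ℂ ↦ x.2.2) ((ContinuousLinearMap.snd ℝ ℂ ℂ).comp
      (ContinuousLinearMap.snd ℝ ℂ (ℂ × ℂ))) x := hasFDerivAt_snd.comp x hasFDerivAt_snd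
  have hγ : HasFDerivAt (fun x : ℂ × ℂ × ℂ ↦ x.2.1) ((ContinuousLinearMap.fst ℝ ℂ ℂ).comp
      (ContinuousLinearMap.snd ℝ ℂ (ℂ × ℂ))) x := hasFDerivAt_fst.comp x hasFDerivAt_snd
  have h1 := hα.comp x (hasFDerivAt_fst (𝕜 := ℝ) (E := ℂ) (F := ℂ × ℂ))
  have h2 := hβ.comp x hγ
  have hW := (hasFDerivAt_const (𝕜 := ℝ) (1 : ℂ) x).prodMk
    (hv.prodMk (hv.mul (h1.sub ((h2.const_mul 2).mul hv))))
  have hW' : HasFDerivAt (isometryField u) _ x := hW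
  have hkey : (2 * (1 - x.1 * conj x.1)⁻¹ ^ 2 : ℂ)
      = 2 * x.2.2 * (((laplacianOn u Ω x.2.1 / 4 : ℝ) : ℂ) * conj x.2.2) := by
    have hne := one_sub_mul_conj_ne_zero hs
    have e : x.2.2 * conj x.2.2 = ((‖x.2.2‖ ^ 2 : ℝ) : ℂ) := by
      rw [Complex.mul_conj, Complex.normSq_eq_norm_sq]
    have hN' : (x.2.2 * conj x.2.2) * (Real.exp (2 * u x.2.1) : ℝ) * (1 - x.1 * conj x.1) ^ 2
        = 4 := by
      rw [e, one_sub_mul_conj]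
      exact_mod_cast hN
    rw [hlap]
    push_cast at hN' ⊢
    field_simp
    linear_combination -hN'
  rw [hW'.fderiv]
  refine Prod.ext ?_ (Prod.ext ?_ ?_)
  · simp
  · simp [isometryField]
  · simp only [isometryField]
    simp
    push_cast at hkey
    rw [← inv_pow]
    linear_combination x.2.2 * (conj c - c) * hkey

end Field

section Developing

open Set Metric Filter Topology ComplexConjugate

variable {u : ℂ → ℝ} {Ω : Set ℂ} {ζ p v₀ : ℂ} {τ : ℝ} {X : ℝ → ℂ × ℂ × ℂ}

section Solution

variable (hX : IsSolutionOn (fun x ↦ ζ • isometryField u x) (ball 0 1 ×ˢ Ω ×ˢ univ)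
  (0, p, v₀) τ X)

include hX

theorem hasDerivWithinAt_components {t : ℝ} (ht : t ∈ Icc 0 τ) :
    HasDerivWithinAt (fun t ↦ (X t).1) ζ (Icc 0 τ) t ∧
    HasDerivWithinAt (fun t ↦ (X t).2.1) (ζ * (X t).2.2) (Icc 0 τ) t ∧
    HasDerivWithinAt (fun t ↦ (X t).2.2) (ζ * ((X t).2.2 *
      (discCoeff (X t).1 - 2 * wirtinger u (X t).2.1 * (X t).2.2))) (Icc 0 τ) t := by
  have h := hX.deriv t ht
  have h2 := (hasFDerivAt_snd (𝕜 := ℝ) (p := X t)).comp_hasDerivWithinAt t h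
  refine ⟨?_, ?_, ?_⟩
  · have h1 := (hasFDerivAt_fst (𝕜 := ℝ) (p := X t)).comp_hasDerivWithinAt t h
    refine h1.congr_deriv ?_
    simp [isometryField]
  · have h1 := (hasFDerivAt_fst (𝕜 := ℝ) (p := (X t).2)).comp_hasDerivWithinAt t h2
    refine h1.congr_deriv ?_
    simp [isometryField]
  · have h1 := (hasFDerivAt_snd (𝕜 := ℝ) (p := (X t).2)).comp_hasDerivWithinAt t h2
    refine h1.congr_deriv ?_
    simp [isometryField]

theorem fst_eq_of_isSolutionOn {t : ℝ} (ht : t ∈ Icc 0 τ) : (X t).1 = t * ζ := by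
  have hd : ∀ t ∈ Icc 0 τ, HasDerivWithinAt (fun t ↦ (X t).1 - t * ζ) 0 (Icc 0 τ) t :=
    fun t ht ↦ by
      have h := (hasDerivWithinAt_components hX ht).1
      have h' : HasDerivAt (fun t : ℝ ↦ (t : ℂ) * ζ) (1 * ζ) t :=
        Complex.ofRealCLM.hasDerivAt.mul_const ζ
      exact (h.sub h'.hasDerivWithinAt).congr_deriv (by ring)
  have := constant_of_has_deriv_right_zero (fun t ht ↦ (hd t ht).continuousWithinAt)
    (fun t ht ↦ (hd t ⟨ht.1, ht.2.le⟩).Ici_of_Icc ht) t ht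
  rw [hX.init] at this
  simpa [sub_eq_zero] using this

theorem metric_identity_of_isSolutionOn (hΩ : IsOpen Ω) (hu : ContDiffOn ℝ 2 u Ω)
    (h0 : ‖v₀‖ ^ 2 * Real.exp (2 * u p) = 4) {t : ℝ} (ht : t ∈ Icc 0 τ) :
    ‖(X t).2.2‖ ^ 2 * Real.exp (2 * u (X t).2.1) * (1 - ‖(X t).1‖ ^ 2) ^ 2 = 4 := by
  have hd : ∀ t ∈ Icc 0 τ, HasDerivWithinAt (fun t ↦ ‖(X t).2.2‖ ^ 2
      * Real.exp (2 * u (X t).2.1) * (1 - ‖(X t).1‖ ^ 2) ^ 2) 0 (Icc 0 τ) t := fun t ht ↦ by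
    obtain ⟨h1, h2, h3⟩ := hasDerivWithinAt_components hX ht
    have hmem := hX.mem t ht
    have hu' : HasFDerivAt u (fderiv ℝ u (X t).2.1) (X t).2.1 :=
      ((hu.contDiffAt (hΩ.mem_nhds hmem.2.1)).differentiableAt two_ne_zero).hasFDerivAt
    have hu2 := ((hu'.comp_hasDerivWithinAt t h2).const_mul 2).exp
    refine ((h3.norm_sq.mul hu2).mul ((h1.norm_sq.const_sub 1).pow 2)).congr_deriv ?_
    have hs : 1 - ‖(X t).1‖ ^ 2 ≠ 0 := by
      have := mem_ball_zero_iff.1 hmem.1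
      nlinarith [norm_nonneg (X t).1]
    have hcoeff : discCoeff (X t).1 = ((1 - ‖(X t).1‖ ^ 2)⁻¹ : ℝ) * (2 * conj (X t).1) := by
      rw [discCoeff, one_sub_mul_conj, Complex.ofReal_inv]
      ring
    rw [fderiv_apply_eq_two_re_wirtinger, hcoeff]
    simp only [Complex.inner, Function.comp_apply, Pi.mul_apply, Pi.pow_apply]
    have hre : (ζ * ((X t).2.2 * (((1 - ‖(X t).1‖ ^ 2)⁻¹ : ℝ) * (2 * conj (X t).1)
        - 2 * wirtinger u (X t).2.1 * (X t).2.2)) * conj (X t).2.2).re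
        = ‖(X t).2.2‖ ^ 2 * (2 * (1 - ‖(X t).1‖ ^ 2)⁻¹ * (ζ * conj (X t).1).re
          - 2 * (wirtinger u (X t).2.1 * (ζ * (X t).2.2)).re) := by
      have hv : (X t).2.2 * conj (X t).2.2 = ((‖(X t).2.2‖ ^ 2 : ℝ) : ℂ) := by
        rw [Complex.mul_conj, Complex.normSq_eq_norm_sq]
      have : ζ * ((X t).2.2 * (((1 - ‖(X t).1‖ ^ 2)⁻¹ : ℝ) * (2 * conj (X t).1)
          - 2 * wirtinger u (X t).2.1 * (X t).2.2)) * conj (X t).2.2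
          = ((‖(X t).2.2‖ ^ 2 : ℝ) : ℂ) * (((2 * (1 - ‖(X t).1‖ ^ 2)⁻¹ : ℝ) : ℂ)
            * (ζ * conj (X t).1) - ((2 : ℝ) : ℂ) * (wirtinger u (X t).2.1 * (ζ * (X t).2.2))) := by
        rw [← hv]
        push_cast
        ring
      rw [this, Complex.re_ofReal_mul, Complex.sub_re, Complex.re_ofReal_mul,
        Complex.re_ofReal_mul]
    rw [hre]
    generalize (ζ * conj (X t).1).re = a at *
    generalize (wirtinger u (X t).2.1 * (ζ * (X t).2.2)).re = b at *
    field_simp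
    push_cast
    ring
  have := constant_of_has_deriv_right_zero (fun t ht ↦ (hd t ht).continuousWithinAt)
    (fun t ht ↦ (hd t ⟨ht.1, ht.2.le⟩).Ici_of_Icc ht) t ht
  beta_reduce at this
  rw [this, hX.init]
  simpa using h0

theorem speed_bound_of_isSolutionOn (hΩ : IsOpen Ω) (hu : ContDiffOn ℝ 2 u Ω)
    (h0 : ‖v₀‖ ^ 2 * Real.exp (2 * u p) = 4) (hζ : ‖ζ‖ < 1) (hτ : τ ≤ 1) {t : ℝ}
    (ht : t ∈ Icc 0 τ) :
    ‖(X t).1‖ ≤ ‖ζ‖ ∧ Real.exp (u (X t).2.1) * ‖(X t).2.2‖ ≤ 2 / (1 - ‖ζ‖ ^ 2) := by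
  have h1 : ‖(X t).1‖ ≤ ‖ζ‖ := by
    rw [fst_eq_of_isSolutionOn hX ht, norm_mul, Complex.norm_real, Real.norm_of_nonneg ht.1]
    exact mul_le_of_le_one_left (norm_nonneg _) (ht.2.trans hτ)
  refine ⟨h1, ?_⟩
  have hN := metric_identity_of_isSolutionOn hX hΩ hu h0 ht
  have hpos : 0 < 1 - ‖ζ‖ ^ 2 := by nlinarith [norm_nonneg ζ]
  have hsq : ‖(X t).1‖ ^ 2 ≤ ‖ζ‖ ^ 2 := by gcongr
  rw [le_div_iff₀ hpos]
  have he : Real.exp (2 * u (X t).2.1) = Real.exp (u (X t).2.1) ^ 2 := by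
    rw [← Real.exp_nat_mul]
    norm_num
  have h2 : Real.exp (u (X t).2.1) * ‖(X t).2.2‖ * (1 - ‖(X t).1‖ ^ 2) ≤ 2 := by
    refine abs_le_of_sq_le_sq' ?_ (by norm_num) |>.2
    rw [he] at hN
    nlinarith
  refine le_trans ?_ h2
  gcongr

end Solution

theorem exists_isSolutionOn_isometryField (hΩ : IsOpen Ω) (hu : ContDiffOn ℝ 2 u Ω)
    (hcomplete : ConformallyComplete u Ω) (hp : p ∈ Ω)
    (h0 : ‖v₀‖ ^ 2 * Real.exp (2 * u p) = 4) (hζ : ‖ζ‖ < 1) :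
    ∃ X, IsSolutionOn (fun x ↦ ζ • isometryField u x) (ball 0 1 ×ˢ Ω ×ˢ univ) (0, p, v₀) 1 X := by
  have hO : IsOpen (ball (0 : ℂ) 1 ×ˢ Ω ×ˢ (univ : Set ℂ)) :=
    isOpen_ball.prod (hΩ.prod isOpen_univ)
  have hF : ContDiffOn ℝ 1 (fun x ↦ ζ • isometryField u x) (ball 0 1 ×ˢ Ω ×ˢ univ) :=
    (contDiffOn_isometryField hΩ hu).const_smul ζ
  refine (exists_isSolutionOn_or_escape hF hO (x := (0, p, v₀))
    ⟨mem_ball_self one_pos, hp, mem_univ _⟩).resolve_right ?_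
  rintro ⟨T, hT, hT1, X, hX, hesc⟩
  have hmul : ∀ {t s : ℝ}, t ∈ Icc 0 s → s < 1 → T * t ∈ Icc 0 (T * s) ∧ T * s < T := fun ht hs ↦
    ⟨⟨mul_nonneg hT.le ht.1, by gcongr; exact ht.2⟩, by nlinarith⟩
  have hmid : ∀ {t : ℝ}, t ∈ Ico (0 : ℝ) 1 → t ∈ Icc 0 ((t + 1) / 2) ∧ (t + 1) / 2 < 1 :=
    fun ht ↦ ⟨⟨ht.1, by linarith [ht.2]⟩, by linarith [ht.2]⟩
  set γ : ℝ → ℂ := fun t ↦ (X (T * t)).2.1 with hγ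
  have hderiv : ∀ {s : ℝ}, s < 1 → ∀ t ∈ Icc 0 s,
      HasDerivWithinAt γ (T • (ζ * (X (T * t)).2.2)) (Icc 0 s) t := fun {s} hs t ht ↦ by
    have h := (hasDerivWithinAt_components (hX _ (hmul ht hs).2) (hmul ht hs).1).2.1
    have hm : MapsTo (fun t ↦ T * t) (Icc 0 s) (Icc 0 (T * s)) := fun r hr ↦ (hmul hr hs).1
    have := h.scomp t ((hasDerivWithinAt_id t _).const_mul T) hm
    exact this.congr_deriv (by rw [mul_one])
  have hcont : ∀ {s : ℝ}, s < 1 → ContinuousOn (fun t ↦ T • (ζ * (X (T * t)).2.2)) (Icc 0 s) :=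
    fun {s} hs ↦ by
      have hm : MapsTo (fun t ↦ T * t) (Icc 0 s) (Icc 0 (T * s)) := fun r hr ↦ (hmul hr hs).1
      have h : ContinuousOn (fun t ↦ X (T * t)) (Icc 0 s) := by
        rcases le_or_gt 0 s with h0 | h0
        · exact (hX _ (hmul ⟨h0, le_rfl⟩ hs).2).continuousOn.comp
            (continuous_const_mul T).continuousOn hm
        · simp [Icc_eq_empty (not_le.2 h0)]
      exact (continuousOn_const.mul h.snd.snd).const_smul T
  have hinf := hcomplete γ ?_ ?_ ?_ ?_
  · have hbound : ∀ t ∈ Ioo (0 : ℝ) 1, ENNReal.ofReal (Real.exp (u (γ t)) * ‖deriv γ t‖)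
        ≤ ENNReal.ofReal (T * (‖ζ‖ * (2 / (1 - ‖ζ‖ ^ 2)))) := fun t ht ↦ by
      have hm := hmid ⟨ht.1.le, ht.2⟩
      have hd : HasDerivAt γ _ t := (hderiv hm.2 t hm.1).hasDerivAt
        (Icc_mem_nhds ht.1 (by linarith [ht.2]))
      have hs := (speed_bound_of_isSolutionOn (hX _ (hmul hm.1 hm.2).2) hΩ hu h0 hζ
        ((hmul hm.1 hm.2).2.le.trans hT1) (hmul hm.1 hm.2).1).2
      refine ENNReal.ofReal_le_ofReal ?_
      rw [hd.deriv, norm_smul, norm_mul, Real.norm_of_nonneg hT.le]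
      calc _ = T * (‖ζ‖ * (Real.exp (u (X (T * t)).2.1) * ‖(X (T * t)).2.2‖)) := by
            rw [hγ]; ring
        _ ≤ _ := by gcongr
    have := (MeasureTheory.setLIntegral_mono' (μ := MeasureTheory.volume) measurableSet_Ioo
      hbound).trans_lt (by
        rw [MeasureTheory.setLIntegral_const]
        exact ENNReal.mul_lt_top ENNReal.ofReal_lt_top (by simp))
    exact this.ne hinf
  · intro t ht
    have hm := hmid ht
    refine (hderiv hm.2 t hm.1).continuousWithinAt.mono_of_mem_nhdsWithin ?_
    refine mem_nhdsWithin.2 ⟨Iio ((t + 1) / 2), isOpen_Iio, by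
      rw [mem_Iio]; linarith [ht.2], fun r hr ↦ ⟨hr.2.1, (mem_Iio.1 hr.1).le⟩⟩
  · intro t ht
    have hm := hmid ht
    exact ((hX _ (hmul hm.1 hm.2).2).mem _ (hmul hm.1 hm.2).1).2.1
  · intro s hs
    have hm := hmid hs
    refine ⟨1, ![0, s], ?_, rfl, rfl, ?_⟩
    · refine Fin.monotone_iff_le_succ.2 fun i ↦ ?_
      fin_cases i
      simpa using hs.1
    · intro i
      fin_cases i
      have h1 : ContDiffOn ℝ 1 γ (Icc 0 ((s + 1) / 2)) := by
        have hpos : (0 : ℝ) < (s + 1) / 2 := by linarith [hs.1]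
        refine (contDiffOn_one_iff_derivWithin (uniqueDiffOn_Icc hpos)).2
          ⟨fun t ht ↦ (hderiv hm.2 t ht).differentiableWithinAt, ?_⟩
        exact (hcont hm.2).congr fun t ht ↦
          (hderiv hm.2 t ht).derivWithin (uniqueDiffOn_Icc hpos t ht)
      exact h1.mono (Icc_subset_Icc_right hm.1.2)
  · intro K hK hKΩ
    have hcu : ContinuousOn (fun z ↦ Real.exp (-u z) * (2 / (1 - ‖ζ‖ ^ 2))) K :=
      ((Real.continuous_exp.comp_continuousOn (hu.continuousOn.mono hKΩ).neg)).mul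
        continuousOn_const
    obtain ⟨M, hM⟩ := hK.exists_bound_of_continuousOn hcu
    obtain ⟨T₀, hT₀, hout⟩ := hesc (closedBall 0 ‖ζ‖ ×ˢ K ×ˢ closedBall 0 M)
      ((isCompact_closedBall _ _).prod (hK.prod (isCompact_closedBall _ _)))
      (prod_mono (closedBall_subset_ball hζ) (prod_mono hKΩ (subset_univ _)))
    have hlt : T₀ / T < 1 := (div_lt_one hT).2 hT₀
    refine ⟨max 0 ((T₀ / T + 1) / 2), le_max_left _ _, max_lt one_pos (by linarith),
      fun t ht ht1 htK ↦ ?_⟩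
    have ht0 := (max_le_iff.1 ht).1
    have hm := hmid ⟨ht0, ht1⟩
    have hTt : T₀ < T * t := by
      have : T₀ / T < t := by linarith [(max_le_iff.1 ht).2]
      rw [div_lt_iff₀ hT] at this
      linarith
    have hs := speed_bound_of_isSolutionOn (hX _ (hmul hm.1 hm.2).2) hΩ hu h0 hζ
        ((hmul hm.1 hm.2).2.le.trans hT1) (hmul hm.1 hm.2).1
    refine hout (T * t) hTt (by nlinarith) ⟨mem_closedBall_zero_iff.2 hs.1, htK,
      mem_closedBall_zero_iff.2 ?_⟩
    refine le_trans ?_ ((le_abs_self _).trans (hM _ htK))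
    rw [Real.exp_neg, ← div_eq_inv_mul, le_div_iff₀ (Real.exp_pos _), mul_comm]
    exact hs.2

/-- The developing map of a complete metric `e^{2u}|dz|²` of curvature `-1`. -/
theorem exists_developing_map (hΩ : IsOpen Ω) (hu : ContDiffOn ℝ 2 u Ω)
    (hlap : ∀ z ∈ Ω, laplacianOn u Ω z = Real.exp (2 * u z))
    (hcomplete : ConformallyComplete u Ω) (hp : p ∈ Ω) :
    ∃ G : ℂ → ℂ, DifferentiableOn ℂ G (ball 0 1) ∧ MapsTo G (ball 0 1) Ω ∧ G 0 = p ∧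
      deriv G 0 = ((2 * Real.exp (-u p) : ℝ) : ℂ) := by
  set v₀ : ℂ := ((2 * Real.exp (-u p) : ℝ) : ℂ) with hv₀
  have h0 : ‖v₀‖ ^ 2 * Real.exp (2 * u p) = 4 := by
    rw [hv₀, Complex.norm_real, Real.norm_eq_abs, sq_abs, mul_pow, ← Real.exp_nat_mul, mul_assoc,
      ← Real.exp_add]
    norm_num
  have hO : IsOpen (ball (0 : ℂ) 1 ×ˢ Ω ×ˢ (univ : Set ℂ)) :=
    isOpen_ball.prod (hΩ.prod isOpen_univ)
  have hex : ∀ ζ : ℂ, ∃ X, ζ ∈ ball (0 : ℂ) 1 →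
      IsSolutionOn (fun x ↦ ζ • isometryField u x) (ball 0 1 ×ˢ Ω ×ˢ univ) (0, p, v₀) 1 X := by
    intro ζ
    by_cases hζ : ζ ∈ ball (0 : ℂ) 1
    · exact (exists_isSolutionOn_isometryField hΩ hu hcomplete hp h0
        (mem_ball_zero_iff.1 hζ)).imp fun X hX _ ↦ hX
    · exact ⟨0, fun h ↦ absurd h hζ⟩
  choose X hX using hex
  have h1 : (1 : ℝ) ∈ Icc (0 : ℝ) 1 := ⟨zero_le_one, le_rfl⟩
  have hd : ∀ ζ ∈ ball (0 : ℂ) 1, HasDerivAt (fun ζ ↦ (X ζ 1).2.1) (X ζ 1).2.2 ζ := fun ζ hζ ↦ by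
    have h := hasDerivAt_of_isSolutionOn_smul (contDiffOn_isometryField hΩ hu) hO hζ hX
      fun t ht c ↦ fderiv_isometryField_smul hΩ hu (mem_ball_zero_iff.1 ((hX ζ hζ).mem t ht).1)
        ((hX ζ hζ).mem t ht).2.1 (hlap _ ((hX ζ hζ).mem t ht).2.1)
        (metric_identity_of_isSolutionOn (hX ζ hζ) hΩ hu h0 ht) c
    have h' := (hasFDerivAt_snd (𝕜 := ℂ) (p := X ζ 1)).comp_hasDerivAt ζ h
    exact (hasFDerivAt_fst (𝕜 := ℂ) (p := (X ζ 1).2)).comp_hasDerivAt ζ h'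
  have h00 : (0 : ℂ) ∈ ball (0 : ℂ) 1 := mem_ball_self one_pos
  have hX0 : X 0 1 = (0, p, v₀) := by
    have := constant_of_has_deriv_right_zero (hX 0 h00).continuousOn
      (fun t ht ↦ by simpa using ((hX 0 h00).deriv t ⟨ht.1, ht.2.le⟩).Ici_of_Icc ht) 1 h1
    rw [this, (hX 0 h00).init]
  refine ⟨fun ζ ↦ (X ζ 1).2.1, fun ζ hζ ↦ (hd ζ hζ).differentiableAt.differentiableWithinAt,
    fun ζ hζ ↦ ((hX ζ hζ).mem 1 h1).2.1, by simp [hX0], ?_⟩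
  rw [(hd 0 h00).deriv, hX0]

end Developing

section MaximumPrinciple

open Set Metric Filter Topology ComplexConjugate

theorem IsLocalMax.deriv_deriv_nonpos {f : ℝ → ℝ} {x : ℝ} (h : IsLocalMax f x)
    (hc : ContinuousAt f x) : deriv (deriv f) x ≤ 0 := by
  by_contra! hpos
  have hmin := isLocalMin_of_deriv_deriv_pos hpos h.deriv_eq_zero hc
  have hconst : f =ᶠ[𝓝 x] fun _ ↦ f x := by
    filter_upwards [h, hmin] with y h₁ h₂ using le_antisymm h₁ h₂
  have := hconst.deriv.deriv_eq
  simp only [deriv_const', deriv_const] at this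
  exact hpos.ne' this

variable {u : ℂ → ℝ} {Ω : Set ℂ}

theorem fderiv_fderiv_le_of_isLocalMax (hΩ : IsOpen Ω) (hu : ContDiffOn ℝ 2 u Ω) {z e : ℂ}
    (hz : z ∈ Ω) {A B : ℝ} (hA : 0 < A)
    (hmax : IsLocalMax (fun t : ℝ ↦ u (z + t • e) + Real.log (A - B * t - t ^ 2)) 0) :
    fderiv ℝ (fderiv ℝ u) z e e ≤ 2 / A + B ^ 2 / A ^ 2 := by
  have hline : ∀ t : ℝ, HasDerivAt (fun t : ℝ ↦ z + t • e) e t := fun t ↦ by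
    simpa using ((hasDerivAt_id t).smul_const e).const_add z
  have hq : ∀ t : ℝ, HasDerivAt (fun t : ℝ ↦ A - B * t - t ^ 2) (-B - 2 * t) t := fun t ↦ by
    exact ((((hasDerivAt_id t).const_mul B).const_sub A).sub (hasDerivAt_pow 2 t)).congr_deriv
      (by simp)
  have hΩ0 : ∀ᶠ t : ℝ in 𝓝 0, z + t • e ∈ Ω :=
    (hline 0).continuousAt.preimage_mem_nhds (hΩ.mem_nhds (by simpa using hz))
  have hq0 : ∀ᶠ t : ℝ in 𝓝 0, 0 < A - B * t - t ^ 2 :=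
    (hq 0).continuousAt.eventually_const_lt (by simpa using hA)
  have hd : ∀ t : ℝ, z + t • e ∈ Ω → 0 < A - B * t - t ^ 2 →
      HasDerivAt (fun t : ℝ ↦ u (z + t • e) + Real.log (A - B * t - t ^ 2))
        (fderiv ℝ u (z + t • e) e + (-B - 2 * t) / (A - B * t - t ^ 2)) t := fun t ht hqt ↦ by
    have h := ((hu.contDiffAt (hΩ.mem_nhds ht)).differentiableAt two_ne_zero).hasFDerivAt
    have h₁ : HasDerivAt (fun t : ℝ ↦ u (z + t • e)) (fderiv ℝ u (z + t • e) e) t :=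
      h.comp_hasDerivAt t (hline t)
    exact h₁.add ((hq t).log hqt.ne')
  have hev : deriv (fun t : ℝ ↦ u (z + t • e) + Real.log (A - B * t - t ^ 2)) =ᶠ[𝓝 0]
      fun t ↦ fderiv ℝ u (z + t • e) e + (-B - 2 * t) / (A - B * t - t ^ 2) := by
    filter_upwards [hΩ0, hq0] with t ht hqt using (hd t ht hqt).deriv
  have h2 : HasDerivAt (fun t : ℝ ↦ fderiv ℝ u (z + t • e) e + (-B - 2 * t) / (A - B * t - t ^ 2))
      (fderiv ℝ (fderiv ℝ u) z e e + (-2 * A - B ^ 2) / A ^ 2) 0 := by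
    have hz' : z + (0 : ℝ) • e ∈ Ω := by simpa using hz
    have h := (((contDiffOn_fderiv hΩ hu).contDiffAt (hΩ.mem_nhds hz')).differentiableAt
      one_ne_zero).hasFDerivAt
    have h₁ : HasDerivAt (fun t : ℝ ↦ fderiv ℝ u (z + t • e))
        (fderiv ℝ (fderiv ℝ u) (z + (0 : ℝ) • e) e) 0 := h.comp_hasDerivAt 0 (hline 0)
    have h' : HasDerivAt (fun t : ℝ ↦ fderiv ℝ u (z + t • e) e)
        (fderiv ℝ (fderiv ℝ u) z e e) 0 :=
      (h₁.clm_apply (hasDerivAt_const (0 : ℝ) e)).congr_deriv (by simp)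
    have hn : HasDerivAt (fun t : ℝ ↦ -B - 2 * t) (-2) 0 := by
      simpa using ((hasDerivAt_id (0 : ℝ)).const_mul 2).const_sub (-B)
    refine (h'.add (hn.div (hq 0) (by simpa using hA.ne'))).congr_deriv ?_
    congr 1
    simp
    ring
  have hle := hmax.deriv_deriv_nonpos
    (hd 0 (by simpa using hz) (by simpa using hA)).continuousAt
  rw [hev.deriv_eq, h2.deriv] at hle
  have : (-2 * A - B ^ 2) / A ^ 2 = -(2 / A + B ^ 2 / A ^ 2) := by field_simp; ring
  linarith

theorem exp_mul_le_two_of_closedBall_subset (hΩ : IsOpen Ω) (hu : ContDiffOn ℝ 2 u Ω)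
    (hlap : ∀ z ∈ Ω, laplacianOn u Ω z = Real.exp (2 * u z)) {p : ℂ} {r : ℝ} (hr : 0 < r)
    (hsub : closedBall p r ⊆ Ω) : Real.exp (u p) * r ≤ 2 := by
  set m : ℂ → ℝ := fun z ↦ Real.exp (u z) * (r ^ 2 - ‖z - p‖ ^ 2) with hm
  have hmc : ContinuousOn m (closedBall p r) :=
    (Real.continuous_exp.comp_continuousOn (hu.continuousOn.mono hsub)).mul (by fun_prop)
  obtain ⟨z, hz, hmax⟩ := (isCompact_closedBall p r).exists_isMaxOn ⟨p, mem_closedBall_self hr.le⟩ hmc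
  have hpz : Real.exp (u p) * r ^ 2 ≤ m z := by
    have := hmax (mem_closedBall_self hr.le)
    simpa [hm] using this
  set A := r ^ 2 - ‖z - p‖ ^ 2 with hAdef
  have hA : 0 < A := by
    have : 0 < Real.exp (u z) * A := lt_of_lt_of_le (by positivity) hpz
    exact (mul_pos_iff_of_pos_left (Real.exp_pos _)).1 this
  have hzΩ := hsub hz
  have hdir : ∀ e : ℂ, ‖e‖ = 1 → fderiv ℝ (fderiv ℝ u) z e e
      ≤ 2 / A + (2 * (conj e * (z - p)).re) ^ 2 / A ^ 2 := fun e he ↦ by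
    have hquad : ∀ t : ℝ, r ^ 2 - ‖z + t • e - p‖ ^ 2
        = A - 2 * (conj e * (z - p)).re * t - t ^ 2 := fun t ↦ by
      have : z + t • e - p = (z - p) + t • e := by ring
      rw [this, norm_add_sq_real, norm_smul, he, hAdef, real_inner_smul_right, real_inner_comm,
        Complex.inner, mul_one, Real.norm_eq_abs, sq_abs, mul_comm (z - p)]
      ring
    refine fderiv_fderiv_le_of_isLocalMax hΩ hu hzΩ hA ?_
    have hball : ∀ᶠ t : ℝ in 𝓝 0, 0 < r ^ 2 - ‖z + t • e - p‖ ^ 2 := by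
      have : ContinuousAt (fun t : ℝ ↦ r ^ 2 - ‖z + t • e - p‖ ^ 2) 0 := by fun_prop
      exact this.eventually_const_lt (by simpa only [zero_smul, add_zero] using hA)
    filter_upwards [hball] with t ht
    have hmem : z + t • e ∈ closedBall p r := by
      rw [mem_closedBall_iff_norm]
      exact (abs_le_of_sq_le_sq (by linarith) hr.le)  |> fun h ↦ (le_abs_self _).trans h
    have hle : m (z + t • e) ≤ m z := hmax hmem
    have hlog := Real.log_le_log (mul_pos (Real.exp_pos _) ht) hle
    rw [Real.log_mul (Real.exp_pos _).ne' ht.ne', Real.log_exp, hm] at hlog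
    simp only at hlog
    rw [← hAdef, Real.log_mul (Real.exp_pos _).ne' hA.ne', Real.log_exp, hquad] at hlog
    simpa using hlog
  have h1 := hdir 1 (by simp)
  have h2 := hdir Complex.I (by simp)
  have hl := hlap z hzΩ
  rw [laplacianOn_eq hΩ hzΩ] at hl
  have hnorm : (2 * (conj 1 * (z - p)).re) ^ 2 + (2 * (conj Complex.I * (z - p)).re) ^ 2
      = 4 * ‖z - p‖ ^ 2 := by
    rw [← Complex.normSq_eq_norm_sq, Complex.normSq_apply]
    simp
    ring
  have hexp : Real.exp (u z) ^ 2 ≤ 4 * r ^ 2 / A ^ 2 := by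
    rw [← Real.exp_nat_mul]
    push_cast
    rw [← hl]
    calc _ ≤ _ := add_le_add h1 h2
      _ = (4 * A + ((2 * (conj 1 * (z - p)).re) ^ 2 + (2 * (conj Complex.I * (z - p)).re) ^ 2))
          / A ^ 2 := by field_simp; ring
      _ = 4 * r ^ 2 / A ^ 2 := by rw [hnorm, hAdef]; ring
  rw [le_div_iff₀ (by positivity)] at hexp
  have hmz : m z ≤ 2 * r := by
    refine (abs_le_of_sq_le_sq' ?_ (by positivity)).2
    calc (Real.exp (u z) * A) ^ 2 = Real.exp (u z) ^ 2 * A ^ 2 := by ring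
      _ ≤ 4 * r ^ 2 := hexp
      _ = (2 * r) ^ 2 := by ring
  have : (Real.exp (u p) * r) * r ≤ 2 * r := by
    calc _ = Real.exp (u p) * r ^ 2 := by ring
      _ ≤ _ := hpz.trans hmz
  exact le_of_mul_le_mul_right this hr

end MaximumPrinciple

section Distortion

open Set Metric Filter Topology

variable {Ω : Set ℂ}

/-- A continuous branch of `√(z - q)` on `Ω` omits a disc of radius comparable to its values. -/
theorem norm_div_three_le_norm_sqrt_add {f : ℂ → ℂ} {p q : ℂ} (hf : ContinuousOn f Ω)
    (hsq : ∀ z, f z ^ 2 = z - q) (hball : ball p ‖p - q‖ ⊆ Ω) (hpq : p ≠ q) (z : ℂ) :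
    ‖f p‖ / 3 ≤ ‖f z + f p‖ := by
  by_contra! hlt
  set a := f p with ha
  have ha2 : ‖a‖ ^ 2 = ‖p - q‖ := by rw [← norm_pow, hsq]
  have ha0 : 0 < ‖a‖ := by
    refine norm_pos_iff.2 fun h ↦ hpq (sub_eq_zero.1 ?_)
    rw [← hsq, ← ha, h, zero_pow two_ne_zero]
  have hmaps : MapsTo (fun w ↦ w ^ 2 + q) (ball a (‖a‖ / 3)) Ω := fun w hw ↦ by
    apply hball
    rw [mem_ball_iff_norm] at hw ⊢
    have e : w ^ 2 + q - p = (w - a) * ((w - a) + 2 * a) := by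
      linear_combination hsq p
    have h2 : ‖(w - a) + 2 * a‖ ≤ ‖w - a‖ + 2 * ‖a‖ := by
      refine (norm_add_le _ _).trans ?_
      simp
    rw [e, norm_mul, ← ha2]
    calc ‖w - a‖ * ‖(w - a) + 2 * a‖ ≤ (‖a‖ / 3) * (‖a‖ / 3 + 2 * ‖a‖) := by
          gcongr
          exact h2.trans (by gcongr)
      _ < ‖a‖ ^ 2 := by nlinarith
  have hne : ∀ {w : ℂ}, w ∈ ball a (‖a‖ / 3) → w ≠ 0 := by
    rintro w hw rfl
    rw [mem_ball_iff_norm, zero_sub, norm_neg] at hw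
    linarith
  have haB : a ∈ ball a (‖a‖ / 3) := mem_ball_self (by positivity)
  have hzB : -f z ∈ ball a (‖a‖ / 3) := by
    rw [mem_ball_iff_norm, ← norm_neg]
    have : -(-f z - a) = f z + a := by ring
    rwa [this]
  have hfz : f ((-f z) ^ 2 + q) = f z := by rw [neg_sq, hsq, sub_add_cancel]
  have hfa : f (a ^ 2 + q) = a := by rw [ha, hsq, sub_add_cancel]
  rcases (isPreconnected_ball (x := a) (r := ‖a‖ / 3)).eq_or_eq_neg_of_sq_eq
    (f := fun w ↦ f (w ^ 2 + q)) (g := id) (hf.comp (by fun_prop) hmaps) continuousOn_id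
    (fun w _ ↦ by simp [hsq]) hne with h | h
  · have := h hzB
    simp only [hfz, id] at this
    exact hne hzB (by linear_combination (-1 / 2) * this)
  · have := h haB
    simp only [hfa, Pi.neg_apply, id] at this
    exact hne haB (by linear_combination (1 / 2) * this)

/-- A weak form of the Koebe one-quarter theorem, without injectivity. -/
theorem norm_deriv_le_mul_infDist {G : ℂ → ℂ} {p : ℂ} (hΩ : IsOpen Ω)
    (hsc : IsSimplyConnected Ω) (hΩne : Ω ≠ univ) (hG : DifferentiableOn ℂ G (ball 0 1))
    (hGm : MapsTo G (ball 0 1) Ω) (hG0 : G 0 = p) :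
    ‖deriv G 0‖ ≤ 48 * infDist p Ωᶜ := by
  have h00 : (0 : ℂ) ∈ ball (0 : ℂ) 1 := mem_ball_self one_pos
  have hp : p ∈ Ω := hG0 ▸ hGm h00
  obtain ⟨q, hq, hdq⟩ := hΩ.isClosed_compl.exists_infDist_eq_dist
    (nonempty_compl.2 hΩne) p
  rw [hdq, dist_eq_norm]
  have hpq : p ≠ q := fun h ↦ hq (h ▸ hp)
  have hball : ball p ‖p - q‖ ⊆ Ω := fun w hw ↦ by
    by_contra hw'
    have := infDist_le_dist_of_mem (x := p) (mem_compl hw')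
    rw [hdq, dist_eq_norm, dist_comm] at this
    exact not_lt.2 this (mem_ball.1 hw)
  obtain ⟨f, hf, hsq⟩ := Complex.exists_continuousOn_pow_eq hsc hΩ (g := fun z ↦ z - q)
    (by fun_prop) (by
      rintro ⟨z, hz, hzq⟩
      exact hq (sub_eq_zero.1 hzq ▸ hz)) two_ne_zero
  have homit := norm_div_three_le_norm_sqrt_add hf hsq hball hpq
  have hfne : ∀ z ∈ Ω, f z ≠ 0 := fun z hz h ↦ by
    have := hsq z
    rw [h, zero_pow two_ne_zero] at this
    exact hq (sub_eq_zero.1 this.symm ▸ hz)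
  have hfd : ∀ z ∈ Ω, HasDerivAt f (2 * f z)⁻¹ z := fun z hz ↦ by
    refine HasDerivAt.of_local_left_inverse (f := fun w ↦ w ^ 2 + q)
      (hf.continuousAt (hΩ.mem_nhds hz)) ?_ (mul_ne_zero two_ne_zero (hfne z hz))
      (Eventually.of_forall fun y ↦ by rw [hsq, sub_add_cancel])
    simpa using (hasDerivAt_pow 2 (f z)).add_const q
  set a := f p with ha
  have ha0 : 0 < ‖a‖ := norm_pos_iff.2 (hfne p hp)
  have ha2 : ‖a‖ ^ 2 = ‖p - q‖ := by rw [← norm_pow, hsq]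
  have hden : ∀ ζ ∈ ball (0 : ℂ) 1, f (G ζ) + a ≠ 0 := fun ζ _ ↦ norm_pos_iff.1
    (lt_of_lt_of_le (by positivity) (homit _))
  have hH : ∀ ζ ∈ ball (0 : ℂ) 1, HasDerivAt (fun ζ ↦ (f (G ζ) + a)⁻¹)
      (-((2 * f (G ζ))⁻¹ * deriv G ζ) / (f (G ζ) + a) ^ 2) ζ := fun ζ hζ ↦ by
    have hGd := (hG.differentiableAt (isOpen_ball.mem_nhds hζ)).hasDerivAt
    exact (((hfd _ (hGm hζ)).comp ζ hGd).add_const a).inv (hden ζ hζ)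
  have hsub : closedBall (0 : ℂ) (1 / 2) ⊆ ball 0 1 := closedBall_subset_ball (by norm_num)
  have hcauchy := Complex.norm_deriv_le_of_forall_mem_sphere_norm_le (c := 0) (R := 1 / 2)
    (C := 3 / ‖a‖) (f := fun ζ ↦ (f (G ζ) + a)⁻¹) (by norm_num)
    (DifferentiableOn.diffContOnCl_ball (U := ball 0 1)
      (fun ζ hζ ↦ (hH ζ hζ).differentiableAt.differentiableWithinAt) hsub)
    (fun ζ _ ↦ by
      rw [norm_inv, ← inv_div]
      exact inv_anti₀ (by positivity) (homit _))
  rw [(hH 0 h00).deriv, hG0, ← ha, norm_div, norm_neg, norm_mul, norm_inv, norm_pow, ← two_mul,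
    norm_mul, Complex.norm_two] at hcauchy
  rw [← ha2]
  have e : (2 * ‖a‖)⁻¹ * ‖deriv G 0‖ / (2 * ‖a‖) ^ 2 = ‖deriv G 0‖ / (8 * ‖a‖ ^ 3) := by
    field_simp
    ring
  rw [e, div_le_iff₀ (by positivity)] at hcauchy
  refine hcauchy.trans_eq ?_
  field_simp
  ring

end Distortion

/-- There is a constant `b ∈ (1, ∞)` such that: if `Ω ⊊ ℂ` is a nonempty open,
connected, simply connected proper subset and `u` is a C² solution of `Δu = e^{2u}`
on `Ω` whose conformal metric is complete, then for all `p ∈ Ω`,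
`(1/2)·dist(p, ∂Ω) ≤ e^{-u p} ≤ (b/2)·dist(p, ∂Ω)`, where the distance is to the
complement `ℂ \ Ω`. -/
theorem poincare_metric_distance_estimate :
    ∃ b : ℝ, 1 < b ∧ ∀ (Ω : Set ℂ) (u : ℂ → ℝ),
      Ω.Nonempty → IsOpen Ω → IsConnected Ω → SimplyConnectedSpace Ω →
      Ω ≠ Set.univ →
      ContDiffOn ℝ 2 u Ω →
      (∀ z ∈ Ω, laplacianOn u Ω z = Real.exp (2 * u z)) →
      ConformallyComplete u Ω →
      ∀ p ∈ Ω,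
        (1 / 2) * Metric.infDist p Ωᶜ ≤ Real.exp (-u p) ∧
        Real.exp (-u p) ≤ (b / 2) * Metric.infDist p Ωᶜ := by
  refine ⟨48, by norm_num, fun Ω u _ hΩ _ hsc hΩne hu hlap hcomplete p hp ↦ ⟨?_, ?_⟩⟩
  · refine le_of_forall_lt_imp_le_of_dense fun c hc ↦ ?_
    rcases le_or_gt c 0 with hc0 | hc0
    · exact hc0.trans (Real.exp_pos _).le
    have hsub : Metric.closedBall p (2 * c) ⊆ Ω := fun w hw ↦ by
      by_contra hw'
      have := Metric.infDist_le_dist_of_mem (x := p) (Set.mem_compl hw')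
      rw [dist_comm] at this
      linarith [Metric.mem_closedBall.1 hw]
    have := exp_mul_le_two_of_closedBall_subset hΩ hu hlap (by linarith) hsub
    rw [Real.exp_neg, ← one_div, le_div_iff₀ (Real.exp_pos _)]
    linarith
  · obtain ⟨G, hG, hGm, hG0, hGd⟩ := exists_developing_map hΩ hu hlap hcomplete hp
    have := norm_deriv_le_mul_infDist hΩ hsc hΩne hG hGm hG0
    rw [hGd, Complex.norm_real, Real.norm_of_nonneg (by positivity)] at this
    linarith
end

section
/- (Koebe's normal family theorem) The family 𝒮 of injective holomorphic functions f : D₁ → ℂ with f(0) = 0 and f'(0) = 1 is compact in the topology of locally uniform convergence: every sequence (f_ν) in 𝒮 has a subsequence converging uniformly on every compact subset of D₁ to some f ∈ 𝒮. -/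
open Metric Set Filter Topology

namespace Complex

/-- A nonvanishing holomorphic function on a disk has a holomorphic logarithm, which we normalize
to vanish at the center. -/
theorem exists_eq_mul_exp_of_ne_zero {f : ℂ → ℂ} {c : ℂ} {r : ℝ} (hr : 0 < r)
    (hf : DifferentiableOn ℂ f (ball c r)) (hne : ∀ z ∈ ball c r, f z ≠ 0) :
    ∃ u : ℂ → ℂ, DifferentiableOn ℂ u (ball c r) ∧ u c = 0 ∧
      ∀ z ∈ ball c r, f z = f c * exp (u z) := by
  obtain ⟨u, huc, hu⟩ :=
    ((hf.deriv isOpen_ball).div hf hne).isExactOn_ball.with_val_at c 0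
  have hd : ∀ z ∈ ball c r, HasDerivAt (fun z => f z * exp (-u z)) 0 z := fun z hz => by
    have h := (hf.differentiableAt (isOpen_ball.mem_nhds hz)).hasDerivAt.mul (hu z hz).neg.cexp
    convert! h using 1
    have := hne z hz
    simp only [Pi.div_apply, Pi.neg_apply]
    field_simp
    ring
  refine ⟨u, fun z hz => (hu z hz).differentiableAt.differentiableWithinAt, huc, fun z hz => ?_⟩
  have h := isOpen_ball.is_const_of_deriv_eq_zero (convex_ball c r).isPreconnected
    (fun z hz => (hd z hz).differentiableAt.differentiableWithinAt)
    (fun z hz => (hd z hz).deriv) hz (mem_ball_self hr)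
  simp only [huc, neg_zero, exp_zero, mul_one] at h
  rw [← h, mul_assoc, ← exp_add, neg_add_cancel, exp_zero, mul_one]

variable {f : ℂ → ℂ} {U : Set ℂ}

theorem not_eventually_eq_of_injOn (hU : IsOpen U) (hinj : InjOn f U) {z : ℂ} (hz : z ∈ U) :
    ¬ ∀ᶠ w in 𝓝 z, f w = f z := fun h => by
  have h' : ∀ᶠ w in 𝓝 z, w = z := by
    filter_upwards [h, hU.mem_nhds hz] with w hw hwU using hinj hwU hz hw
  obtain ⟨w, hw, hne⟩ := ((h'.filter_mono nhdsWithin_le_nhds).and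
    (self_mem_nhdsWithin (a := z) (s := {z}ᶜ))).exists
  exact hne hw

theorem nhds_le_map_of_injOn (hU : IsOpen U) (hf : DifferentiableOn ℂ f U) (hinj : InjOn f U)
    {z : ℂ} (hz : z ∈ U) : 𝓝 (f z) ≤ map f (𝓝 z) :=
  (hf.analyticAt (hU.mem_nhds hz)).eventually_constant_or_nhds_le_map_nhds.resolve_left
    (not_eventually_eq_of_injOn hU hinj hz)

theorem isOpen_image_of_injOn (hU : IsOpen U) (hf : DifferentiableOn ℂ f U) (hinj : InjOn f U) :
    IsOpen (f '' U) := by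
  rw [isOpen_iff_mem_nhds]
  rintro _ ⟨z, hz, rfl⟩
  exact nhds_le_map_of_injOn hU hf hinj hz (image_mem_map (hU.mem_nhds hz))

theorem continuousAt_invFunOn_of_injOn (hU : IsOpen U) (hf : DifferentiableOn ℂ f U)
    (hinj : InjOn f U) {z : ℂ} (hz : z ∈ U) :
    ContinuousAt (Function.invFunOn f U) (f z) := by
  refine Tendsto.mono_left (tendsto_map'_iff.2 ?_) (nhds_le_map_of_injOn hU hf hinj hz)
  rw [hinj.leftInvOn_invFunOn hz]
  refine tendsto_id.congr' ?_
  filter_upwards [hU.mem_nhds hz] with w hw using (hinj.leftInvOn_invFunOn hw).symm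

/-- The inverse of an injective holomorphic function is holomorphic. -/
theorem differentiableOn_invFunOn_of_injOn (hU : IsOpen U) (hf : DifferentiableOn ℂ f U)
    (hinj : InjOn f U) : DifferentiableOn ℂ (Function.invFunOn f U) (f '' U) := by
  rintro _ ⟨z, hz, rfl⟩
  refine (analyticAt_of_differentiable_on_punctured_nhds_of_continuousAt ?_
    (continuousAt_invFunOn_of_injOn hU hf hinj hz)).differentiableAt.differentiableWithinAt
  have hO := isOpen_image_of_injOn hU hf hinj
  have hderiv : ∀ᶠ w in 𝓝[≠] z, deriv f w ≠ 0 := by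
    refine ((hf.deriv hU).analyticAt
      (hU.mem_nhds hz)).eventually_eq_zero_or_eventually_ne_zero.resolve_left fun h => ?_
    obtain ⟨r, hr, hball⟩ := Metric.eventually_nhds_iff_ball.1 (h.and (hU.mem_nhds hz))
    refine not_eventually_eq_of_injOn hU hinj hz ?_
    filter_upwards [ball_mem_nhds z hr] with w hw
    exact isOpen_ball.is_const_of_deriv_eq_zero (convex_ball z r).isPreconnected
      (hf.mono fun w hw => (hball w hw).2) (fun w hw => (hball w hw).1) hw (mem_ball_self hr)
  have htend : Tendsto (Function.invFunOn f U) (𝓝[≠] (f z)) (𝓝[≠] z) := by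
    have hc := continuousAt_invFunOn_of_injOn hU hf hinj hz
    rw [ContinuousAt, hinj.leftInvOn_invFunOn hz] at hc
    refine tendsto_nhdsWithin_iff.2 ⟨hc.mono_left nhdsWithin_le_nhds, ?_⟩
    filter_upwards [self_mem_nhdsWithin, nhdsWithin_le_nhds (hO.mem_nhds (mem_image_of_mem f hz))]
      with y hy hyU h
    exact hy (by rw [mem_singleton_iff, ← Function.invFunOn_eq hyU, h])
  filter_upwards [htend.eventually hderiv,
    nhdsWithin_le_nhds (hO.mem_nhds (mem_image_of_mem f hz))]
  rintro _ hne ⟨w, hw, rfl⟩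
  refine (HasDerivAt.of_local_left_inverse (continuousAt_invFunOn_of_injOn hU hf hinj hw)
    (hf.differentiableAt (hU.mem_nhds ?_)).hasDerivAt hne ?_).differentiableAt
  · exact Function.invFunOn_mem (mem_image_of_mem f hw)
  · filter_upwards [hO.mem_nhds (mem_image_of_mem f hw)] with y hy using Function.invFunOn_eq hy


/-- **Montel's theorem**: a sequence of holomorphic functions on an open set which is locally
uniformly bounded has a locally uniformly convergent subsequence. -/
theorem exists_subseq_tendstoLocallyUniformlyOn {U : Set ℂ} (hU : IsOpen U) {F : ℕ → ℂ → ℂ}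
    (hF : ∀ n, DifferentiableOn ℂ (F n) U)
    (hb : ∀ z ∈ U, ∃ M : ℝ, ∀ᶠ w in 𝓝 z, ∀ n, ‖F n w‖ ≤ M) :
    ∃ (f : ℂ → ℂ) (φ : ℕ → ℕ), StrictMono φ ∧
      TendstoLocallyUniformlyOn (fun n => F (φ n)) f atTop U := by
  have hmod : ∀ z ∈ U, ∃ r > 0, ∃ L M : ℝ, ∀ n, ‖F n z‖ ≤ M ∧
      ∀ w ∈ ball z r, dist (F n w) (F n z) ≤ L * dist w z := by
    intro z hz
    obtain ⟨M, hM⟩ := hb z hz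
    obtain ⟨r, hr, hball⟩ := Metric.eventually_nhds_iff_ball.1 (hM.and (hU.mem_nhds hz))
    refine ⟨r, hr, (M + M) / r, M, fun n => ⟨(hball z (mem_ball_self hr)).1 n, fun w hw => ?_⟩⟩
    refine dist_le_div_mul_dist_of_mapsTo_ball ((hF n).mono fun w hw => (hball w hw).2)
      (fun x hx => ?_) hw
    exact (dist_le_norm_add_norm _ _).trans
      (add_le_add ((hball x hx).1 n) ((hball z (mem_ball_self hr)).1 n))
  choose! r hr L M hLM using hmod
  have : LocallyCompactSpace U := hU.locallyCompactSpace
  let S : Set C(U, ℂ) := {g | ∀ z : U, ‖g z‖ ≤ M z ∧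
    ∀ w : U, (w : ℂ) ∈ ball (z : ℂ) (r z) → dist (g w) (g z) ≤ L z * dist (w : ℂ) z}
  have hlim (z : U) : Tendsto (fun w : U => L z * dist (w : ℂ) z) (𝓝 z) (𝓝 0) := by
    have : Continuous fun w : U => L z * dist (w : ℂ) z := by fun_prop
    simpa using this.tendsto z
  have hnhds (z : U) : ∀ᶠ w : U in 𝓝 z, (w : ℂ) ∈ ball (z : ℂ) (r z) :=
    continuous_subtype_val.continuousAt.eventually (ball_mem_nhds _ (hr z z.2))
  have hS : IsCompact S := by
    refine ArzelaAscoli.isCompact_of_equicontinuous S ?_ fun z => ?_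
    · have himage : ContinuousMap.toFun '' S = {g : U → ℂ | ∀ z : U, ‖g z‖ ≤ M z ∧
          ∀ w : U, (w : ℂ) ∈ ball (z : ℂ) (r z) → dist (g w) (g z) ≤ L z * dist (w : ℂ) z} := by
        refine Subset.antisymm (by rintro _ ⟨g, hg, rfl⟩; exact hg) fun g hg => ?_
        refine ⟨⟨g, continuous_iff_continuousAt.2 fun z => ?_⟩, hg, rfl⟩
        refine tendsto_iff_dist_tendsto_zero.2 (squeeze_zero' (.of_forall fun _ => dist_nonneg)
          ?_ (hlim z))
        filter_upwards [hnhds z] with w hw using (hg z).2 w hw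
      rw [himage]
      refine (isCompact_univ_pi fun z : U => isCompact_closedBall (0 : ℂ) (M z)).of_isClosed_subset
        ?_ fun g hg z _ => mem_closedBall_zero_iff.2 (hg z).1
      simp only [ofPred_forall, ofPred_and]
      refine isClosed_iInter fun z => (isClosed_le (by fun_prop) (by fun_prop)).inter ?_
      exact isClosed_iInter fun w => isClosed_iInter fun _ =>
        isClosed_le (by fun_prop) (by fun_prop)
    · refine equicontinuousAt_of_continuity_modulus _ (hlim z) _ ?_
      filter_upwards [hnhds z] with w hw g
      rw [dist_comm]
      exact (g.2 z).2 w hw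
  obtain ⟨g, -, φ, hφ, hg⟩ := hS.tendsto_subseq
    (x := fun n => ⟨U.domRestrict (F n), (hF n).continuousOn.domRestrict⟩)
    fun n z => ⟨(hLM z z.2 n).1, fun w hw => (hLM z z.2 n).2 w hw⟩
  refine ⟨Function.extend Subtype.val g 0, φ, hφ, ?_⟩
  rw [tendstoLocallyUniformlyOn_iff_tendstoLocallyUniformly_comp_coe,
    Function.extend_comp Subtype.val_injective]
  exact ContinuousMap.tendsto_iff_tendstoLocallyUniformly.1 hg

/-- **Hurwitz's theorem**: a locally uniform limit of injective holomorphic functions is injective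
unless it is constant. -/
theorem injOn_of_tendstoLocallyUniformlyOn {U : Set ℂ} (hU : IsOpen U) (hUc : IsPreconnected U)
    {ι : Type*} {l : Filter ι} [l.NeBot] {F : ι → ℂ → ℂ} {f : ℂ → ℂ}
    (hF : ∀ᶠ n in l, DifferentiableOn ℂ (F n) U) (hinj : ∀ᶠ n in l, InjOn (F n) U)
    (hlim : TendstoLocallyUniformlyOn F f l U) (hconst : ¬ ∃ c, EqOn f (fun _ => c) U) :
    InjOn f U := by
  have hf : DifferentiableOn ℂ f U := hlim.differentiableOn hF hU
  have hfa : AnalyticOnNhd ℂ f U := hf.analyticOnNhd hU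
  intro a ha b hb hab
  by_contra hne
  have hpunct : ∀ᶠ z in 𝓝[≠] b, f z ≠ f b := by
    refine ((hfa b hb).eventually_eq_or_eventually_ne analyticAt_const).resolve_left fun h => ?_
    exact hconst ⟨f b, hfa.eqOn_of_preconnected_of_eventuallyEq analyticOnNhd_const hUc hb h⟩
  rw [eventually_nhdsWithin_iff] at hpunct
  obtain ⟨r, hr, hball⟩ := nhds_basis_closedBall.eventually_iff.1
    ((hpunct.and (hU.mem_nhds hb)).and (isOpen_ne.mem_nhds (Ne.symm hne)))
  have hsub : closedBall b r ⊆ U := fun z hz => (hball hz).1.2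
  obtain ⟨ε, hε, hsphere⟩ : ∃ ε > 0, ∀ z ∈ sphere b r, ε ≤ ‖f z - f b‖ := by
    obtain ⟨x, hx, hmin⟩ := (isCompact_sphere b r).exists_isMinOn
      (NormedSpace.sphere_nonempty.2 hr.le)
      (f := fun z => ‖f z - f b‖)
      ((hf.continuousOn.mono (sphere_subset_closedBall.trans hsub)).sub continuousOn_const).norm
    refine ⟨‖f x - f b‖, norm_pos_iff.2 (sub_ne_zero.2 ?_), fun z hz => hmin hz⟩
    exact (hball (sphere_subset_closedBall hx)).1.1 (ne_of_mem_sphere hx hr.ne')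
  have hunif : TendstoUniformlyOn F f l (closedBall b r) :=
    (tendstoLocallyUniformlyOn_iff_forall_isCompact hU).1 hlim _ hsub (isCompact_closedBall b r)
  obtain ⟨n, ⟨⟨hFn, hinjn⟩, hclose⟩, hclose_a⟩ := (((hF.and hinj).and
    (Metric.tendstoUniformlyOn_iff.1 hunif (ε / 16) (by positivity))).and
    (Metric.tendsto_nhds.1 (hlim.tendsto_at ha) (ε / 16) (by positivity))).exists
  have hbb := hclose b (mem_closedBall_self hr.le)
  have himage := (hFn.diffContOnCl_ball hsub).ball_subset_image_closedBall (ε := ε / 2) hr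
    (fun z hz => ?_) ?_
  · have hmem : F n a ∈ ball (F n b) (ε / 2 / 2) := by
      rw [mem_ball]
      have := dist_triangle4 (F n a) (f a) (f b) (F n b)
      rw [hab, dist_self] at this
      rw [hab] at hclose_a
      linarith
    obtain ⟨z, hz, hza⟩ := himage hmem
    exact (hball hz).2 (hinjn (hsub hz) ha hza)
  · have h1 := hclose z (sphere_subset_closedBall hz)
    have h2 := hsphere z hz
    rw [← dist_eq_norm] at h2 ⊢
    have := dist_triangle4 (f z) (F n z) (F n b) (f b)
    rw [dist_comm (F n b) (f b)] at this
    linarith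
  · have h : ∃ᶠ z in 𝓝[≠] b, F n z ≠ F n b := by
      refine Eventually.frequently ?_
      filter_upwards [self_mem_nhdsWithin, nhdsWithin_le_nhds (hU.mem_nhds hb)] with z hz hzU h
      exact hz (hinjn hzU hb h)
    exact h.filter_mono nhdsWithin_le_nhds

/-- A normalized injective holomorphic function on the unit disk omits a value `a` of modulus at
most one such that its image contains the disk of radius `‖a‖` about the origin. -/
theorem exists_notMem_image_and_ball_subset (hf : DifferentiableOn ℂ f (ball 0 1))
    (hinj : InjOn f (ball 0 1)) (h0 : f 0 = 0) (h1 : deriv f 0 = 1) :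
    ∃ a, a ∉ f '' ball 0 1 ∧ ‖a‖ ≤ 1 ∧ ball 0 ‖a‖ ⊆ f '' ball 0 1 := by
  have hO := isOpen_image_of_injOn isOpen_ball hf hinj
  have hmem : (0 : ℂ) ∈ ball (0 : ℂ) 1 := mem_ball_self one_pos
  have hinv := differentiableOn_invFunOn_of_injOn isOpen_ball hf hinj
  have hinv0 : Function.invFunOn f (ball 0 1) 0 = 0 := by
    simpa only [h0] using hinj.leftInvOn_invFunOn hmem
  have h0mem : (0 : ℂ) ∈ f '' ball 0 1 := ⟨0, hmem, h0⟩
  have hR : ∀ R : ℝ, ball 0 R ⊆ f '' ball 0 1 → R ≤ 1 := by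
    intro R hsub
    by_contra! hlt
    have hle : ‖deriv (Function.invFunOn f (ball 0 1)) 0‖ ≤ 1 / R := by
      refine norm_deriv_le_div_of_mapsTo_ball (hinv.mono hsub) (fun w hw => ?_) (by linarith)
      rw [hinv0]
      exact ball_subset_closedBall (Function.invFunOn_mem (hsub hw))
    have hcomp : HasDerivAt (Function.invFunOn f (ball 0 1) ∘ f)
        (deriv (Function.invFunOn f (ball 0 1)) 0 * deriv f 0) 0 := by
      refine HasDerivAt.comp 0 ?_ (hf.differentiableAt (isOpen_ball.mem_nhds hmem)).hasDerivAt
      rw [h0]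
      exact (hinv.differentiableAt (hO.mem_nhds h0mem)).hasDerivAt
    have hid : HasDerivAt (Function.invFunOn f (ball 0 1) ∘ f) 1 0 := by
      refine (hasDerivAt_id (0 : ℂ)).congr_of_eventuallyEq ?_
      filter_upwards [isOpen_ball.mem_nhds hmem] with z hz using hinj.leftInvOn_invFunOn hz
    have heq := hcomp.unique hid
    rw [h1, mul_one] at heq
    rw [heq, norm_one, le_div_iff₀ (by linarith)] at hle
    linarith
  have hne : (f '' ball 0 1)ᶜ.Nonempty := by
    rw [nonempty_compl]
    intro h
    exact absurd (hR 2 (h ▸ subset_univ _)) (by norm_num)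
  obtain ⟨a, ha, hdist⟩ := hO.isClosed_compl.exists_infDist_eq_dist hne 0
  rw [dist_zero_left] at hdist
  have hsub : ball 0 ‖a‖ ⊆ f '' ball 0 1 := by
    intro w hw
    by_contra hwn
    have := infDist_le_dist_of_mem (x := (0 : ℂ)) (mem_compl hwn)
    rw [hdist, dist_zero_left] at this
    exact absurd (mem_ball_zero_iff.1 hw) this.not_gt
  exact ⟨a, ha, hR _ hsub, hsub⟩

/-- If `h` is holomorphic and nonvanishing on the unit disk, `h 0 = 1`, and the values of `h` stay
at distance at least `1 / 3` from `-1`, then `h` satisfies an explicit growth bound. -/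
theorem norm_le_of_le_norm_add_one {h : ℂ → ℂ} (hd : DifferentiableOn ℂ h (ball 0 1))
    (h0 : h 0 = 1) (hfar : ∀ z ∈ ball (0 : ℂ) 1, 1 / 3 ≤ ‖h z + 1‖) {z : ℂ}
    (hz : z ∈ ball (0 : ℂ) 1) :
    ‖h z‖ ≤ 1 + 2 * Real.exp (4 * ‖z‖ / (1 - ‖z‖)) := by
  have hne : ∀ z ∈ ball (0 : ℂ) 1, h z + 1 ≠ 0 := fun z hz =>
    norm_pos_iff.1 (lt_of_lt_of_le (by norm_num) (hfar z hz))
  obtain ⟨u, hu, hu0, hexp⟩ := exists_eq_mul_exp_of_ne_zero one_pos (hd.add_const 1) hne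
  rw [h0] at hexp
  have hre : MapsTo (fun z => -u z) (ball 0 1) {z | z.re ≤ 2} := by
    intro w hw
    have h1 := hfar w hw
    rw [hexp w hw, norm_mul, norm_exp] at h1
    have h2 : ‖(1 + 1 : ℂ)‖ = 2 := by norm_num
    rw [h2] at h1
    have h3 : Real.exp (-(u w).re) ≤ Real.exp 2 := by
      have h4 : (6 : ℝ) ≤ Real.exp 2 := by
        have := Real.exp_one_gt_d9
        have h5 : Real.exp 2 = Real.exp 1 * Real.exp 1 := by rw [← Real.exp_add]; norm_num
        nlinarith
      rw [Real.exp_neg]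
      refine le_trans ?_ h4
      rw [inv_le_comm₀ (Real.exp_pos _) (by norm_num)]
      linarith
    simpa using Real.exp_le_exp.1 h3
  have hbound := borelCaratheodory_zero two_pos hu.neg hre one_pos hz (by simp [hu0])
  rw [Pi.neg_apply, norm_neg, show (2 * 2 : ℝ) = 4 by norm_num] at hbound
  calc ‖h z‖ = ‖(1 + 1) * exp (u z) - 1‖ := by rw [← hexp z hz, add_sub_cancel_right]
    _ ≤ ‖(1 + 1) * exp (u z)‖ + ‖(1 : ℂ)‖ := norm_sub_le _ _
    _ = 1 + 2 * ‖exp (u z)‖ := by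
      rw [norm_mul, norm_one, show ‖(1 + 1 : ℂ)‖ = 2 by norm_num]; ring
    _ ≤ 1 + 2 * Real.exp (4 * ‖z‖ / (1 - ‖z‖)) := by
      gcongr
      exact (norm_exp_le_exp_norm _).trans (Real.exp_le_exp.2 hbound)

/-- An explicit growth bound for normalized injective holomorphic functions on the unit disk. -/
theorem norm_le_of_injOn_ball (hf : DifferentiableOn ℂ f (ball 0 1))
    (hinj : InjOn f (ball 0 1)) (h0 : f 0 = 0) (h1 : deriv f 0 = 1) {z : ℂ}
    (hz : z ∈ ball (0 : ℂ) 1) :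
    ‖f z‖ ≤ 1 + (1 + 2 * Real.exp (4 * ‖z‖ / (1 - ‖z‖))) ^ 2 := by
  obtain ⟨a, ha, ha1, hsub⟩ := exists_notMem_image_and_ball_subset hf hinj h0 h1
  have hmem : (0 : ℂ) ∈ ball (0 : ℂ) 1 := mem_ball_self one_pos
  have ha0 : a ≠ 0 := by rintro rfl; exact ha ⟨0, hmem, h0⟩
  obtain ⟨u, hu, hu0, hexp⟩ := exists_eq_mul_exp_of_ne_zero (f := fun z => 1 - f z / a) one_pos
    ((hf.div_const a).const_sub 1) fun z hz h => ha ⟨z, hz, by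
      rw [sub_eq_zero, eq_div_iff ha0, one_mul] at h; exact h.symm⟩
  simp only [h0, zero_div, sub_zero, one_mul] at hexp
  set h : ℂ → ℂ := fun z => exp (u z / 2)
  have hh : DifferentiableOn ℂ h (ball 0 1) := (hu.div_const 2).cexp
  have hsq : ∀ z ∈ ball (0 : ℂ) 1, h z ^ 2 = 1 - f z / a := fun z hz => by
    rw [hexp z hz, ← exp_nat_mul]; congr 1; push_cast; ring
  have hfeq : ∀ z ∈ ball (0 : ℂ) 1, f z = a * (1 - h z ^ 2) := fun z hz => by
    rw [hsq z hz]; field_simp; ring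
  have hh0 : h 0 = 1 := by simp [h, hu0]
  have hinvmem : ∀ v ∈ ball (1 : ℂ) (1 / 3), a * (1 - v ^ 2) ∈ f '' ball 0 1 := by
    intro v hv
    refine hsub (mem_ball_zero_iff.2 ?_)
    rw [mem_ball, dist_eq_norm] at hv
    have hv' : ‖v + 1‖ < 7 / 3 := by
      calc ‖v + 1‖ = ‖(v - 1) + 2‖ := by ring_nf
        _ ≤ ‖v - 1‖ + ‖(2 : ℂ)‖ := norm_add_le _ _
        _ < 7 / 3 := by rw [norm_ofNat]; linarith
    have hlt : ‖1 - v ^ 2‖ < 1 := by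
      rw [show 1 - v ^ 2 = -((v - 1) * (v + 1)) by ring, norm_neg, norm_mul]
      nlinarith [norm_nonneg (v - 1), norm_nonneg (v + 1)]
    rw [norm_mul]
    exact mul_lt_of_lt_one_right (norm_pos_iff.2 ha0) hlt
  have hsect : EqOn (fun v => h (Function.invFunOn f (ball 0 1) (a * (1 - v ^ 2)))) id
      (ball 1 (1 / 3)) := by
    refine (convex_ball (1 : ℂ) (1 / 3)).isPreconnected.eq_of_sq_eq ?_ continuousOn_id ?_ ?_
      (mem_ball_self (by norm_num)) ?_
    · refine hh.continuousOn.comp ((differentiableOn_invFunOn_of_injOn isOpen_ball hf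
        hinj).continuousOn.comp (by fun_prop) hinvmem) fun v hv =>
          Function.invFunOn_mem (hinvmem v hv)
    · intro v hv
      have := Function.invFunOn_eq (hinvmem v hv)
      simp only [Pi.pow_apply, id]
      rw [hsq _ (Function.invFunOn_mem (hinvmem v hv)), this]
      field_simp
      ring
    · rintro v hv rfl
      norm_num [mem_ball, dist_eq_norm] at hv
    · have := hinj.leftInvOn_invFunOn hmem
      rw [h0] at this
      simp [this, hh0]
  have hfar : ∀ z ∈ ball (0 : ℂ) 1, 1 / 3 ≤ ‖h z + 1‖ := by
    intro z hz
    by_contra! hlt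
    have hv : -h z ∈ ball (1 : ℂ) (1 / 3) := by
      rw [mem_ball, dist_eq_norm, ← norm_neg]
      convert! hlt using 2
      ring
    have := hsect hv
    simp only [neg_sq, id] at this
    rw [← hfeq z hz, hinj.leftInvOn_invFunOn hz, self_eq_neg] at this
    exact exp_ne_zero _ this
  have hbound := norm_le_of_le_norm_add_one hh hh0 hfar hz
  rw [hfeq z hz, norm_mul]
  calc ‖a‖ * ‖1 - h z ^ 2‖ ≤ 1 * (‖(1 : ℂ)‖ + ‖h z ^ 2‖) := by
        gcongr
        exact norm_sub_le _ _
    _ ≤ _ := by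
        rw [one_mul, norm_one, norm_pow]
        gcongr

end Complex

/-- **Koebe's normal family theorem.** The family `𝒮` of injective holomorphic
functions `f : D₁ → ℂ` with `f 0 = 0`, `f' 0 = 1` is sequentially compact in the
topology of locally uniform convergence on the unit disk. -/
theorem koebe_normal_family
    (F : ℕ → ℂ → ℂ)
    (hdiff : ∀ ν, DifferentiableOn ℂ (F ν) (Metric.ball 0 1))
    (hinj : ∀ ν, Set.InjOn (F ν) (Metric.ball 0 1))
    (hzero : ∀ ν, F ν 0 = 0)
    (hderiv : ∀ ν, deriv (F ν) 0 = 1) :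
    ∃ (f : ℂ → ℂ) (φ : ℕ → ℕ), StrictMono φ ∧
      DifferentiableOn ℂ f (Metric.ball 0 1) ∧ Set.InjOn f (Metric.ball 0 1) ∧
      f 0 = 0 ∧ deriv f 0 = 1 ∧
      ∀ K : Set ℂ, K ⊆ Metric.ball 0 1 → IsCompact K →
        TendstoUniformlyOn (fun ν => F (φ ν)) f Filter.atTop K := by
  have hmem : (0 : ℂ) ∈ ball (0 : ℂ) 1 := mem_ball_self one_pos
  obtain ⟨f, φ, hφ, hlim⟩ := Complex.exists_subseq_tendstoLocallyUniformlyOn isOpen_ball hdiff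
    fun z hz => by
      have hz' := mem_ball_zero_iff.1 hz
      have hcont : ContinuousAt
          (fun w : ℂ => 1 + (1 + 2 * Real.exp (4 * ‖w‖ / (1 - ‖w‖))) ^ 2) z := by
        have : 1 - ‖z‖ ≠ 0 := by linarith
        fun_prop (disch := assumption)
      obtain ⟨M, hM⟩ := exists_gt (1 + (1 + 2 * Real.exp (4 * ‖z‖ / (1 - ‖z‖))) ^ 2)
      refine ⟨M, ?_⟩
      filter_upwards [hcont.eventually (Iio_mem_nhds hM), isOpen_ball.mem_nhds hz]
        with w hw hwU n
      exact (Complex.norm_le_of_injOn_ball (hdiff n) (hinj n) (hzero n) (hderiv n) hwU).trans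
        hw.le
  have hd : ∀ᶠ n in atTop, DifferentiableOn ℂ (F (φ n)) (ball 0 1) := .of_forall fun n => hdiff _
  have hf1 : deriv f 0 = 1 := by
    refine tendsto_nhds_unique ((hlim.deriv hd isOpen_ball).tendsto_at hmem) ?_
    simp [hderiv]
  refine ⟨f, φ, hφ, hlim.differentiableOn hd isOpen_ball, ?_, ?_, hf1,
    (tendstoLocallyUniformlyOn_iff_forall_isCompact isOpen_ball).1 hlim⟩
  · refine Complex.injOn_of_tendstoLocallyUniformlyOn isOpen_ball
      (convex_ball 0 1).isPreconnected hd (.of_forall fun n => hinj _) hlim ?_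
    rintro ⟨c, hc⟩
    have : f =ᶠ[𝓝 0] fun _ => c := by
      filter_upwards [isOpen_ball.mem_nhds hmem] with z hz using hc hz
    rw [this.deriv_eq, deriv_const] at hf1
    exact zero_ne_one hf1
  · refine tendsto_nhds_unique (hlim.tendsto_at hmem) ?_
    simp [hzero]
end

section
/- Let Ω ⊆ ℂ be a nonempty open connected set and suppose there exists a holomorphic covering map f : ℂ → ℂ with f(ℂ) = Ω which is a topological covering map onto Ω. Then there is no C² function w : Ω → ℝ satisfying Δw ≥ e^{2w} on Ω; that is, Ω carries no conformal metric e^{2w}|dz|² of Gaussian curvature ≤ −1. -/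
/-- `f` is a holomorphic covering map from `D ⊆ ℂ` onto `Ω ⊆ ℂ`. -/
def IsHolomorphicCoveringOnto (f : ℂ → ℂ) (D Ω : Set ℂ) : Prop :=
  DifferentiableOn ℂ f D ∧ f '' D = Ω ∧
    ∀ h : Set.MapsTo f D Ω, IsCoveringMap (Set.MapsTo.restrict f D Ω h)

open Complex InnerProductSpace Laplacian Filter Topology

theorem laplacian_eq_fderiv_fderiv_complexPlane (u : ℂ → ℝ) (z : ℂ) :
    Δ u z = fderiv ℝ (fderiv ℝ u) z 1 1 + fderiv ℝ (fderiv ℝ u) z I I := by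
  simp [laplacian_eq_iteratedFDeriv_complexPlane, iteratedFDeriv_two_apply]

/-- The iterated derivative of `u` along a line is given by the second Fréchet derivative. -/
theorem ContDiffAt.deriv_deriv_comp_line {u : ℂ → ℝ} {z : ℂ} (hu : ContDiffAt ℝ 2 u z) (v : ℂ) :
    deriv (deriv fun t : ℝ ↦ u (z + t • v)) 0 = fderiv ℝ (fderiv ℝ u) z v v := by
  have hline (t : ℝ) : HasDerivAt (fun t : ℝ ↦ z + t • v) v t := by
    simpa using ((hasDerivAt_id t).smul_const v).const_add z
  have hnhds : Tendsto (fun t : ℝ ↦ z + t • v) (𝓝 0) (𝓝 z) := by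
    simpa using (hline 0).continuousAt.tendsto
  have hd : (deriv fun t : ℝ ↦ u (z + t • v)) =ᶠ[𝓝 0] fun t ↦ fderiv ℝ u (z + t • v) v := by
    filter_upwards [hnhds.eventually (hu.eventually (by simp))] with t ht
    exact ((ht.differentiableAt (by simp)).hasFDerivAt.comp_hasDerivAt t (hline t)).deriv
  rw [hd.deriv_eq]
  have h2 : HasFDerivAt (fderiv ℝ u) (fderiv ℝ (fderiv ℝ u) z) (z + (0 : ℝ) • v) := by
    rw [zero_smul, add_zero]
    exact ((hu.fderiv_right (m := 1) (by norm_num)).differentiableAt (by simp)).hasFDerivAt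
  have h3 : HasDerivAt (fun t : ℝ ↦ fderiv ℝ u (z + t • v)) (fderiv ℝ (fderiv ℝ u) z v) 0 :=
    h2.comp_hasDerivAt (0 : ℝ) (hline 0)
  have h4 : HasDerivAt (fun t : ℝ ↦ fderiv ℝ u (z + t • v) v) (fderiv ℝ (fderiv ℝ u) z v v) 0 :=
    (ContinuousLinearMap.apply ℝ ℝ v).hasFDerivAt.comp_hasDerivAt (0 : ℝ) h3
  exact h4.deriv

/-- The second-derivative test along a line. -/
theorem IsLocalMax.fderiv_fderiv_nonpos {u : ℂ → ℝ} {z : ℂ} (hmax : IsLocalMax u z)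
    (hu : ContDiffAt ℝ 2 u z) (v : ℂ) : fderiv ℝ (fderiv ℝ u) z v v ≤ 0 := by
  rw [← hu.deriv_deriv_comp_line v]
  set g : ℝ → ℝ := fun t ↦ u (z + t • v)
  have hline : ContinuousAt (fun t : ℝ ↦ z + t • v) 0 := by fun_prop
  have hnhds : Tendsto (fun t : ℝ ↦ z + t • v) (𝓝 0) (𝓝 z) := by
    simpa using hline.tendsto
  have hgmax : IsLocalMax g 0 := by
    filter_upwards [hnhds.eventually hmax] with t ht
    simpa [g] using ht
  have hgc : ContinuousAt g 0 := by
    refine ContinuousAt.comp (g := u) ?_ hline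
    simpa using hu.continuousAt
  by_contra! hpos
  have hgmin := isLocalMin_of_deriv_deriv_pos hpos hgmax.deriv_eq_zero hgc
  have hconst : g =ᶠ[𝓝 0] fun _ ↦ g 0 := by
    filter_upwards [hgmax, hgmin] with t h1 h2 using le_antisymm h1 h2
  have : deriv (deriv g) 0 = 0 := by
    rw [hconst.deriv.deriv_eq]
    simp
  exact hpos.ne' this

theorem IsLocalMax.laplacian_nonpos {u : ℂ → ℝ} {z : ℂ} (hmax : IsLocalMax u z)
    (hu : ContDiffAt ℝ 2 u z) : Δ u z ≤ 0 := by
  rw [laplacian_eq_fderiv_fderiv_complexPlane]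
  exact add_nonpos (hmax.fderiv_fderiv_nonpos hu 1) (hmax.fderiv_fderiv_nonpos hu I)

/-- The conformal transformation rule for the Laplacian. -/
theorem laplacian_comp_analyticAt {u : ℂ → ℝ} {F : ℂ → ℂ} {z : ℂ}
    (hu : ContDiffAt ℝ 2 u (F z)) (hF : AnalyticAt ℂ F z) :
    Δ (u ∘ F) z = ‖deriv F z‖ ^ 2 * Δ u (F z) := by
  have hFR : ContDiffAt ℝ 2 F z := hF.contDiffAt.restrict_scalars ℝ
  have hd : fderiv ℝ (u ∘ F) =ᶠ[𝓝 z] fun y ↦ (fderiv ℝ u (F y)).comp (fderiv ℝ F y) := by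
    filter_upwards [hF.continuousAt.tendsto.eventually (hu.eventually (by simp)),
      hFR.eventually (by simp)] with y h1 h2
    exact fderiv_comp y (h1.differentiableAt (by simp)) (h2.differentiableAt (by simp))
  have h1 : HasFDerivAt F (fderiv ℝ F z) z := (hFR.differentiableAt (by simp)).hasFDerivAt
  have h2 : HasFDerivAt (fderiv ℝ F) (fderiv ℝ (fderiv ℝ F) z) z :=
    ((hFR.fderiv_right (m := 1) (by norm_num)).differentiableAt (by simp)).hasFDerivAt
  have h3 : HasFDerivAt (fderiv ℝ u) (fderiv ℝ (fderiv ℝ u) (F z)) (F z) :=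
    ((hu.fderiv_right (m := 1) (by norm_num)).differentiableAt (by simp)).hasFDerivAt
  have hharm : fderiv ℝ (fderiv ℝ F) z 1 1 + fderiv ℝ (fderiv ℝ F) z I I = 0 := by
    simpa [laplacian_eq_iteratedFDeriv_complexPlane, iteratedFDeriv_two_apply] using
      hF.harmonicAt.2.self_of_nhds
  have hFd (v : ℂ) : fderiv ℝ F z v = deriv F z * v := by
    rw [(hF.differentiableAt.hasDerivAt.hasFDerivAt.restrictScalars ℝ).fderiv]
    simp [mul_comm]
  have hsnd (v : ℂ) : fderiv ℝ (fderiv ℝ (u ∘ F)) z v v =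
      fderiv ℝ u (F z) (fderiv ℝ (fderiv ℝ F) z v v) +
        fderiv ℝ (fderiv ℝ u) (F z) (deriv F z * v) (deriv F z * v) := by
    have h4 := (h3.comp z h1).clm_comp h2
    simp only [Function.comp_apply] at h4
    rw [hd.fderiv_eq, h4.fderiv]
    simp [hFd]
  rw [laplacian_eq_fderiv_fderiv_complexPlane, laplacian_eq_fderiv_fderiv_complexPlane, hsnd, hsnd,
    add_add_add_comm, ← map_add, hharm, map_zero, zero_add]
  set B := fderiv ℝ (fderiv ℝ u) (F z)
  set a := deriv F z
  have e1 : a * 1 = a.re • (1 : ℂ) + a.im • I := by simp [re_add_im]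
  have e2 : a * I = a.re • I - a.im • (1 : ℂ) := by
    apply Complex.ext <;> simp
  rw [e1, e2, ← normSq_eq_norm_sq, normSq_apply]
  simp only [map_add, map_sub, map_smul, add_apply,
    sub_apply, smul_apply, smul_eq_mul]
  ring

theorem contDiffAt_log_sub_normSq {R : ℝ} {z : ℂ} (hz : normSq z < R ^ 2) :
    ContDiffAt ℝ 2 (fun y : ℂ ↦ Real.log (R ^ 2 - normSq y)) z := by
  have : ContDiffAt ℝ 2 (fun y : ℂ ↦ R ^ 2 - normSq y) z := by
    simp only [normSq_eq_norm_sq]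
    exact contDiffAt_const.sub (contDiff_norm_sq ℝ).contDiffAt
  exact this.log (ne_of_gt (sub_pos.2 hz))

/-- The curvature equation of the Poincaré metric on a disc. -/
theorem laplacian_log_sub_normSq {R : ℝ} {z : ℂ} (hz : normSq z < R ^ 2) :
    Δ (fun y : ℂ ↦ Real.log (R ^ 2 - normSq y)) z = -(4 * R ^ 2 / (R ^ 2 - normSq z) ^ 2) := by
  have hh : 0 < R ^ 2 - normSq z := sub_pos.2 hz
  have hsnd (v : ℂ) (hv : normSq v = 1) :
      fderiv ℝ (fderiv ℝ fun y : ℂ ↦ Real.log (R ^ 2 - normSq y)) z v v =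
        -2 / (R ^ 2 - normSq z) -
          4 * (z.re * v.re + z.im * v.im) ^ 2 / (R ^ 2 - normSq z) ^ 2 := by
    rw [← (contDiffAt_log_sub_normSq hz).deriv_deriv_comp_line v]
    set b := z.re * v.re + z.im * v.im
    set h := R ^ 2 - normSq z
    have hv' : v.re * v.re + v.im * v.im = 1 := by rw [← normSq_apply, hv]
    have hline (t : ℝ) : R ^ 2 - normSq (z + t • v) = h - 2 * b * t - t ^ 2 := by
      simp only [h, b, normSq_apply, add_re, add_im, real_smul, re_ofReal_mul, im_ofReal_mul]
      linear_combination (-t ^ 2) * hv'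
    simp only [hline]
    have hp (t : ℝ) : HasDerivAt (fun t : ℝ ↦ h - 2 * b * t - t ^ 2) (-2 * b - 2 * t) t := by
      have := (((hasDerivAt_id t).const_mul (2 * b)).const_sub h).sub (hasDerivAt_pow 2 t)
      exact this.congr_deriv (by simp)
    have hne : ∀ᶠ t : ℝ in 𝓝 0, h - 2 * b * t - t ^ 2 ≠ 0 :=
      (hp 0).continuousAt.eventually_ne (by simpa using hh.ne')
    have hd : (deriv fun t : ℝ ↦ Real.log (h - 2 * b * t - t ^ 2)) =ᶠ[𝓝 0]
        fun t ↦ (-2 * b - 2 * t) / (h - 2 * b * t - t ^ 2) := by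
      filter_upwards [hne] with t ht using ((hp t).log ht).deriv
    rw [hd.deriv_eq]
    have hnum : HasDerivAt (fun t : ℝ ↦ -2 * b - 2 * t) (-2) 0 := by
      simpa using ((hasDerivAt_id (0 : ℝ)).const_mul 2).const_sub (-2 * b)
    rw [(hnum.fun_div (hp 0) hne.self_of_nhds).deriv]
    have hh0 : h ≠ 0 := hh.ne'
    simp only [mul_zero, sub_zero, ne_eq, OfNat.ofNat_ne_zero, not_false_eq_true, zero_pow]
    field_simp
    ring
  rw [laplacian_eq_fderiv_fderiv_complexPlane, hsnd 1 (by simp), hsnd I (by simp)]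
  have hR : R ^ 2 = (R ^ 2 - normSq z) + (z.re * z.re + z.im * z.im) := by
    rw [normSq_apply]; ring
  generalize R ^ 2 - normSq z = h at *
  rw [hR]
  simp only [one_re, one_im, I_re, I_im]
  field_simp
  ring

/-- The Ahlfors–Schwarz lemma at the center of a disc: a holomorphic map into a domain with a
metric `e^{2w}|dz|²` of curvature at most `-1` does not increase the hyperbolic metric. -/
theorem ahlfors_schwarz_center {Ω : Set ℂ} (hopen : IsOpen Ω) {w : ℂ → ℝ}
    (hw : ContDiffOn ℝ 2 w Ω) (hcurv : ∀ z ∈ Ω, Real.exp (2 * w z) ≤ Δ w z)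
    {F : ℂ → ℂ} (hF : Differentiable ℂ F) (hmaps : ∀ z, F z ∈ Ω) {R : ℝ} (hR : 0 < R) :
    R * (‖deriv F 0‖ * Real.exp (w (F 0))) ≤ 2 := by
  have hF' : Differentiable ℂ (deriv F) := hF.deriv
  have hwat (z : ℂ) : ContDiffAt ℝ 2 w (F z) := hw.contDiffAt (hopen.mem_nhds (hmaps z))
  let φ : ℂ → ℝ := fun z ↦ (R ^ 2 - normSq z) * (‖deriv F z‖ * Real.exp (w (F z)))
  have hφc : Continuous φ := by
    have h1 : Continuous fun z ↦ w (F z) := continuous_iff_continuousAt.2 fun z ↦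
      (hwat z).continuousAt.comp (hF z).continuousAt
    have h2 := hF'.continuous
    have h3 := Complex.continuous_normSq
    exact (continuous_const.sub h3).mul (h2.norm.mul h1.rexp)
  obtain ⟨z, hz, hmax⟩ := (isCompact_closedBall (0 : ℂ) R).exists_isMaxOn
    (Metric.nonempty_closedBall.2 hR.le) hφc.continuousOn
  have h0 : φ 0 ≤ φ z := hmax (by simp [hR.le])
  suffices hle : φ z ≤ 2 * R by
    have : R * (R * (‖deriv F 0‖ * Real.exp (w (F 0)))) ≤ R * 2 := by
      simp only [φ, map_zero, sub_zero] at h0 hle ⊢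
      linarith
    exact le_of_mul_le_mul_left this hR
  by_contra! hlt
  have hzR : normSq z ≤ R ^ 2 := by
    rw [normSq_eq_norm_sq]
    exact pow_le_pow_left₀ (norm_nonneg _) (by simpa using hz) 2
  have hφpos : 0 < φ z := by linarith
  have hzlt : normSq z < R ^ 2 := by
    refine lt_of_le_of_ne hzR fun h ↦ ?_
    simp [φ, h] at hφpos
  have hdz : deriv F z ≠ 0 := by
    intro h
    simp [φ, h] at hφpos
  have hzball : z ∈ Metric.ball (0 : ℂ) R := by
    rw [mem_ball_zero_iff]
    rw [normSq_eq_norm_sq] at hzlt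
    exact lt_of_pow_lt_pow_left₀ 2 hR.le hzlt
  have hφmax : IsLocalMax φ z := by
    filter_upwards [Metric.isOpen_ball.mem_nhds hzball] with y hy
    exact hmax (Metric.ball_subset_closedBall hy)
  let u₁ : ℂ → ℝ := fun y ↦ Real.log (R ^ 2 - normSq y)
  let u₂ : ℂ → ℝ := fun y ↦ Real.log ‖deriv F y‖
  have hu₁ : ContDiffAt ℝ 2 u₁ z := contDiffAt_log_sub_normSq hzlt
  have hu₂ : HarmonicAt u₂ z := (hF'.analyticAt z).harmonicAt_log_norm hdz
  have hu₃ : ContDiffAt ℝ 2 (w ∘ F) z :=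
    (hwat z).comp z ((hF.analyticAt z).contDiffAt.restrict_scalars ℝ)
  have hlog : IsLocalMax (u₁ + u₂ + w ∘ F) z := by
    have heq : ∀ᶠ y in 𝓝 z, 0 < φ y ∧ (u₁ + u₂ + w ∘ F) y = Real.log (φ y) := by
      filter_upwards [hφc.continuousAt.eventually (lt_mem_nhds hφpos),
        hF'.continuous.continuousAt.eventually_ne hdz,
        Complex.continuous_normSq.continuousAt.eventually (gt_mem_nhds hzlt)] with y h1 h2 h3
      refine ⟨h1, ?_⟩
      have h4 : R ^ 2 - normSq y ≠ 0 := (sub_pos.2 h3).ne'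
      have h5 : ‖deriv F y‖ ≠ 0 := norm_ne_zero_iff.2 h2
      simp only [φ, u₁, u₂, Pi.add_apply, Function.comp_apply]
      rw [Real.log_mul h4 (mul_ne_zero h5 (Real.exp_pos _).ne'),
        Real.log_mul h5 (Real.exp_pos _).ne', Real.log_exp, add_assoc]
    filter_upwards [heq, hφmax] with y hy hle
    rw [hy.2, heq.self_of_nhds.2]
    exact Real.log_le_log hy.1 hle
  have hu₁₂ : ContDiffAt ℝ 2 (u₁ + u₂) z := hu₁.add hu₂.1
  have hΔ := hlog.laplacian_nonpos (hu₁₂.add hu₃)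
  rw [hu₁₂.laplacian_add hu₃, hu₁.laplacian_add hu₂.1,
    laplacian_log_sub_normSq hzlt, hu₂.2.self_of_nhds,
    laplacian_comp_analyticAt (hwat z) (hF.analyticAt z), Pi.zero_apply, add_zero] at hΔ
  have hexp : Real.exp (2 * w (F z)) = Real.exp (w (F z)) ^ 2 := by
    rw [← Real.exp_nat_mul]; norm_cast
  have hle := mul_le_mul_of_nonneg_left (hcurv _ (hmaps z)) (sq_nonneg ‖deriv F z‖)
  rw [hexp, ← mul_pow] at hle
  have hh : 0 < R ^ 2 - normSq z := sub_pos.2 hzlt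
  have hsq : (‖deriv F z‖ * Real.exp (w (F z))) ^ 2 ≤ 4 * R ^ 2 / (R ^ 2 - normSq z) ^ 2 := by
    linarith
  rw [le_div_iff₀ (by positivity), ← mul_pow, mul_comm] at hsq
  have : φ z ^ 2 ≤ (2 * R) ^ 2 := by
    rw [mul_pow 2 R]
    norm_num
    exact hsq
  exact hlt.not_ge (le_of_sq_le_sq this (by positivity))

/-- An entire function with values in an open set carrying a metric of curvature at most `-1` has
zero derivative. -/
theorem deriv_eq_zero_of_mapsTo_negative_curvature {Ω : Set ℂ} (hopen : IsOpen Ω) {w : ℂ → ℝ}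
    (hw : ContDiffOn ℝ 2 w Ω) (hcurv : ∀ z ∈ Ω, Real.exp (2 * w z) ≤ Δ w z)
    {f : ℂ → ℂ} (hf : Differentiable ℂ f) (hmaps : ∀ z, f z ∈ Ω) (a : ℂ) : deriv f a = 0 := by
  by_contra h
  have hdpos : 0 < ‖deriv f a‖ * Real.exp (w (f a)) :=
    mul_pos (norm_pos_iff.2 h) (Real.exp_pos _)
  have hF : Differentiable ℂ fun z ↦ f (z + a) := by fun_prop
  have hR : 0 < 3 / (‖deriv f a‖ * Real.exp (w (f a))) := by positivity
  have key := ahlfors_schwarz_center hopen hw hcurv hF (fun z ↦ hmaps (z + a)) hR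
  rw [deriv_comp_add_const, zero_add, div_mul_cancel₀ _ hdpos.ne'] at key
  norm_num at key

/-- If a nonempty open connected set `Ω ⊆ ℂ` is holomorphically covered by `ℂ`,
then it carries no C² function `w` with `Δw ≥ e^{2w}`, i.e. no conformal metric of
Gaussian curvature ≤ -1. -/
theorem no_negative_curvature_of_covered_by_plane
    (Ω : Set ℂ) (hne : Ω.Nonempty) (hopen : IsOpen Ω) (hconn : IsConnected Ω)
    (f : ℂ → ℂ) (hf : IsHolomorphicCoveringOnto f Set.univ Ω) :
    ¬ ∃ w : ℂ → ℝ, ContDiffOn ℝ 2 w Ω ∧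
        ∀ z ∈ Ω, Real.exp (2 * w z) ≤ laplacianOn w Ω z := by
  rintro ⟨w, hw, hcurv⟩
  obtain ⟨hdiff, himage, -⟩ := hf
  have hmaps (z : ℂ) : f z ∈ Ω := himage ▸ Set.mem_image_of_mem f (Set.mem_univ z)
  have hcurv' : ∀ z ∈ Ω, Real.exp (2 * w z) ≤ Δ w z := by
    intro z hz
    have := hcurv z hz
    rwa [laplacianOn, iteratedFDerivWithin_of_isOpen 2 hopen hz,
      ← congrFun (laplacian_eq_iteratedFDeriv_complexPlane w) z] at this
  have hfd : Differentiable ℂ f := differentiableOn_univ.1 hdiff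
  have hconst (z : ℂ) : f z = f 0 := is_const_of_deriv_eq_zero hfd
    (deriv_eq_zero_of_mapsTo_negative_curvature hopen hw hcurv' hfd hmaps) z 0
  have hsub : Ω ⊆ {f 0} := by
    rw [← himage]
    rintro _ ⟨z, -, rfl⟩
    exact hconst z
  obtain ⟨c, hc⟩ := hne
  exact not_isOpen_singleton (f 0) <|
    (Set.Subset.antisymm hsub (Set.singleton_subset_iff.2 (hmaps 0))) ▸ hopen
end
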